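/- Weyl versus anti-Wick quantization (quadratic-form version): Let d ≥ 1, N ≥ 1, and let a : ℝ^{2d} → ℝ be a Schwartz function. For ε > 0 set G_ε(z) = (πε)^{−d} e^{−|z|²/ε}, b_ε = Σ_{k=0}^{N−1} (1/k!) (−ε/4)^k Δ^k a (Δ the Laplacian on ℝ^{2d}), and let r_ε = ε^{−N} ( a − G_ε * b_ε ), which is a Schwartz function on ℝ^{2d}. Then there exist constants C' ≥ 0 depending only on d and N such that, with C = C' · max { sup_z |∂^δ a(z)| : δ a multi-index with 2N ≤ |δ| ≤ 2N + 2(⌈d/2⌉ + 1) }, one has for every ε ∈ (0,1] and every Schwartz function ψ : ℝ^d → ℂ the bound |⟨ψ, op_ε(r_ε) ψ⟩_{L²(ℝ^d)}| ≤ C ‖ψ‖²_{L²(ℝ^d)}. In particular, ⟨ψ, op_ε(a) ψ⟩ = ⟨ψ, op_ε(G_ε * b_ε) ψ⟩ + ε^N ⟨ψ, op_ε(r_ε) ψ⟩ with the last term bounded by C ε^N ‖ψ‖² uniformly in ε ∈ (0,1]. -/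

import Mathlib

open MeasureTheory Finset

noncomputable section

/-- Phase space `ℝ^d × ℝ^d`. -/
abbrev PS (d : ℕ) := (Fin d → ℝ) × (Fin d → ℝ)

/-- The Laplacian on phase space `ℝ^{2d}`. -/
def phaseLap {d : ℕ} {F : Type*} [NormedAddCommGroup F] [NormedSpace ℝ F]
    (f : PS d → F) : PS d → F := fun z =>
  (∑ i, iteratedDeriv 2 (fun t => f (Function.update z.1 i t, z.2)) (z.1 i)) +
  (∑ i, iteratedDeriv 2 (fun t => f (z.1, Function.update z.2 i t)) (z.2 i))

/-- Partial derivative in the `i`-th position coordinate. -/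
def pdQ {d : ℕ} (i : Fin d) (f : PS d → ℝ) : PS d → ℝ := fun z =>
  deriv (fun t => f (Function.update z.1 i t, z.2)) (z.1 i)

/-- Partial derivative in the `i`-th momentum coordinate. -/
def pdP {d : ℕ} (i : Fin d) (f : PS d → ℝ) : PS d → ℝ := fun z =>
  deriv (fun t => f (z.1, Function.update z.2 i t)) (z.2 i)

/-- The iterated partial derivative `∂^δ` on phase space associated with a
multi-index `δ : Fin d ⊕ Fin d → ℕ`. -/
def mpdPS {d : ℕ} (δ : Fin d ⊕ Fin d → ℕ) (f : PS d → ℝ) : PS d → ℝ :=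
  (List.finRange d).foldr (fun i g => (pdQ i)^[δ (Sum.inl i)] g)
    ((List.finRange d).foldr (fun i g => (pdP i)^[δ (Sum.inr i)] g) f)

/-- The phase-space Gaussian `G_ε(z) = (πε)^{−d} e^{−|z|²/ε}`. -/
def gaussW0 {d : ℕ} (ε : ℝ) : PS d → ℝ := fun z =>
  (((Real.pi * ε) ^ d : ℝ))⁻¹ * Real.exp (-(∑ i, (z.1 i ^ 2 + z.2 i ^ 2)) / ε)

/-- The corrected symbol `b_ε = Σ_{k<N} (1/k!) (−ε/4)^k Δ^k a`. -/
def corrSymbol {d : ℕ} (N : ℕ) (ε : ℝ) (a : PS d → ℝ) : PS d → ℝ := fun y =>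
  ∑ k ∈ Finset.range N, ((Nat.factorial k : ℝ))⁻¹ * (-ε / 4) ^ k * (phaseLap^[k] a) y

/-- The remainder symbol `r_ε = ε^{−N} (a − G_ε * b_ε)`. -/
def remSymbol {d : ℕ} (N : ℕ) (ε : ℝ) (a : PS d → ℝ) : PS d → ℝ := fun z =>
  (ε ^ N)⁻¹ * (a z - ∫ w : PS d, gaussW0 ε w * corrSymbol N ε a (z - w))

/-- The ε-scaled Weyl quantization `op_ε(c)` of a symbol `c` on phase space. -/
def weylOp {d : ℕ} (ε : ℝ) (c : PS d → ℂ) (ψ : (Fin d → ℝ) → ℂ) :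
    (Fin d → ℝ) → ℂ := fun q =>
  (((2 * Real.pi * ε) ^ d : ℝ))⁻¹ •
    ∫ y : Fin d → ℝ,
      (∫ p : Fin d → ℝ,
        c (fun i => (q i + y i) / 2, p) *
          Complex.exp (Complex.I * (∑ i, (q i - y i) * p i) / ε)) * ψ y

namespace WAW
open SchwartzMap
open scoped Nat ContDiff ENNReal

section gauss
variable {H : Type*} [NormedAddCommGroup H] [InnerProductSpace ℝ H]

lemma poly_exp_bound (b : ℝ) (hb : 0 < b) (K : ℕ) (t : ℝ) (ht : 0 ≤ t) :
    (1 + t) ^ K * Real.exp (-b * t ^ 2) ≤ K ! * Real.exp (1 + 1 / (4 * b)) := by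
  have h1 : (1 + t) ^ K ≤ K ! * Real.exp (1 + t) := by
    have := Real.pow_div_factorial_le_exp (1 + t) (by linarith) K
    rw [div_le_iff₀ (by positivity)] at this
    linarith
  have h2 : (1 + t) + (-b * t ^ 2) ≤ 1 + 1 / (4 * b) := by
    have : 0 ≤ b * (t - 1 / (2 * b)) ^ 2 := by positivity
    have e : b * (t - 1 / (2 * b)) ^ 2 = b * t ^ 2 - t + 1 / (4 * b) := by
      field_simp; ring
    linarith
  calc (1 + t) ^ K * Real.exp (-b * t ^ 2) ≤ (K ! * Real.exp (1 + t)) * Real.exp (-b * t ^ 2) := by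
        gcongr
    _ = K ! * Real.exp ((1 + t) + (-b * t ^ 2)) := by rw [mul_assoc, ← Real.exp_add]
    _ ≤ _ := by gcongr

lemma gauss_decay (b : ℝ) (hb : 0 < b) (k n : ℕ) : ∃ C : ℝ, ∀ x : H,
    ‖x‖ ^ k * ‖iteratedFDeriv ℝ n (fun x : H => Real.exp (-b * ‖x‖ ^ 2)) x‖ ≤ C := by
  have hf : (fun x : H => -b * ‖x‖ ^ 2).HasTemperateGrowth :=
    (Function.HasTemperateGrowth.const (-b)).mul (Function.hasTemperateGrowth_norm_sq H)
  obtain ⟨k₁, C₁, hC₁, h₁⟩ := hf.norm_iteratedFDeriv_le_uniform n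
  refine ⟨n ! * (1 + C₁) ^ n * ((k + k₁ * n) ! * Real.exp (1 + 1 / (4 * b))), fun x => ?_⟩
  have key := norm_iteratedFDeriv_comp_le (𝕜 := ℝ) (g := Real.exp) (f := fun x : H => -b * ‖x‖ ^ 2)
    (n := n) (N := ∞) (x := x) Real.contDiff_exp hf.1 (by exact_mod_cast le_top)
    (C := Real.exp (-b * ‖x‖ ^ 2)) (D := (1 + C₁) * (1 + ‖x‖) ^ k₁) ?_ ?_
  · have hx1 : ‖x‖ ^ k ≤ (1 + ‖x‖) ^ k := by gcongr; linarith
    have := poly_exp_bound b hb (k + k₁ * n) ‖x‖ (norm_nonneg x)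
    calc _ ≤ (1 + ‖x‖) ^ k * (n ! * Real.exp (-b * ‖x‖ ^ 2) * ((1 + C₁) * (1 + ‖x‖) ^ k₁) ^ n) := by
          gcongr
          exact key
      _ = n ! * (1 + C₁) ^ n * ((1 + ‖x‖) ^ (k + k₁ * n) * Real.exp (-b * ‖x‖ ^ 2)) := by
          rw [mul_pow, pow_add, pow_mul]; ring
      _ ≤ _ := by gcongr
  · intro i _
    rw [norm_iteratedFDeriv_eq_norm_iteratedDeriv, iteratedDeriv_eq_iterate, Real.iter_deriv_exp]
    simp
  · intro i hi hin
    have h2 : (1 : ℝ) ≤ (1 + C₁) * (1 + ‖x‖) ^ k₁ := by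
      have : (1 : ℝ) ≤ (1 + ‖x‖) ^ k₁ := one_le_pow₀ (by linarith [norm_nonneg x])
      nlinarith
    calc _ ≤ C₁ * (1 + ‖x‖) ^ k₁ := h₁ i hin x
      _ ≤ (1 + C₁) * (1 + ‖x‖) ^ k₁ := by gcongr; linarith
      _ ≤ _ := le_self_pow₀ h2 (by omega)

/-- The Gaussian `exp (-b ‖x‖²)` as a Schwartz function. -/
def gaussS (b : ℝ) (hb : 0 < b) : 𝓢(H, ℝ) where
  toFun := fun x => Real.exp (-b * ‖x‖ ^ 2)
  smooth' := by
    have hf : (fun x : H => -b * ‖x‖ ^ 2).HasTemperateGrowth :=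
      (Function.HasTemperateGrowth.const (-b)).mul (Function.hasTemperateGrowth_norm_sq H)
    exact Real.contDiff_exp.comp hf.1
  decay' := fun k n => gauss_decay b hb k n

@[simp] lemma gaussS_apply (b : ℝ) (hb : 0 < b) (x : H) :
    gaussS b hb x = Real.exp (-b * ‖x‖ ^ 2) := rfl

end gauss

section kernel
variable {E : Type*} [NormedAddCommGroup E] [NormedSpace ℝ E] [FiniteDimensional ℝ E]
  [MeasurableSpace E] [BorelSpace E] (μ : Measure E) [μ.IsAddHaarMeasure]

lemma shear_lintegral (F : E → E → ℝ≥0∞) (hF : Measurable (Function.uncurry F)) :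
    ∫⁻ m, ∫⁻ z, F (m + (1 / 2 : ℝ) • z) (m - (1 / 2 : ℝ) • z) ∂μ ∂μ = ∫⁻ x, ∫⁻ y, F x y ∂μ ∂μ := by
  have e1 : ∀ z m : E, m - (1 / 2 : ℝ) • z = (m + (1 / 2 : ℝ) • z) - z := by
    intro z m; module
  have hm : Measurable (fun p : E × E => F (p.1 + (1 / 2 : ℝ) • p.2) (p.1 - (1 / 2 : ℝ) • p.2)) := by
    apply hF.comp (f := fun p : E × E => (p.1 + (1 / 2 : ℝ) • p.2, p.1 - (1 / 2 : ℝ) • p.2))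
    fun_prop
  rw [lintegral_lintegral_swap hm.aemeasurable]
  have : ∀ z : E, ∫⁻ m, F (m + (1 / 2 : ℝ) • z) (m - (1 / 2 : ℝ) • z) ∂μ = ∫⁻ x, F x (x - z) ∂μ := by
    intro z
    simp_rw [e1]
    exact lintegral_add_right_eq_self (fun x => F x (x - z)) ((1 / 2 : ℝ) • z)
  simp_rw [this]
  rw [lintegral_lintegral_swap]
  · congr with x
    exact lintegral_sub_left_eq_self (fun y => F x y) x
  · exact (hF.comp (f := fun p : E × E => (p.2, p.2 - p.1)) (by fun_prop)).aemeasurable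

open Metric in
lemma kernel_ball (U : E → ℝ≥0∞) (hU : Measurable U) (R : ℝ) (hR : 0 < R) :
    ∫⁻ m, (∫⁻ z in closedBall 0 R, U (m + (1 / 2 : ℝ) • z) * U (m - (1 / 2 : ℝ) • z) ∂μ) ^ (1 / 2 : ℝ) ∂μ
      ≤ ENNReal.ofReal (2 ^ Module.finrank ℝ E) * (μ (closedBall 0 R)) ^ (1 / 2 : ℝ) * ∫⁻ x, U x ∂μ := by
  set A : E → ℝ≥0∞ := fun m => ∫⁻ z in closedBall 0 R, U (m + (1 / 2 : ℝ) • z) * U (m - (1 / 2 : ℝ) • z) ∂μ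
    with hA
  have hAm : Measurable A := by
    apply Measurable.lintegral_prod_right' (f := fun p : E × E => U (p.1 + (1 / 2 : ℝ) • p.2) * U (p.1 - (1 / 2 : ℝ) • p.2))
    exact (hU.comp (by fun_prop)).mul (hU.comp (by fun_prop))
  set v := μ (closedBall (0 : E) R) with hv
  have hvc : ∀ c, μ (closedBall c R) = v := fun c => Measure.addHaar_closedBall_center μ c R
  have hv2c : ∀ c, μ (closedBall c (2 * R)) = ENNReal.ofReal (2 ^ Module.finrank ℝ E) * v := by
    intro c
    rw [Measure.addHaar_closedBall_center, Measure.addHaar_closedBall_mul μ _ (by norm_num) hR.le]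
  have hv0 : v ≠ 0 := (measure_closedBall_pos μ _ hR).ne'
  have hvt : v ≠ ⊤ := (measure_closedBall_lt_top).ne
  -- averaging
  have h1 : (∫⁻ m, A m ^ (1 / 2 : ℝ) ∂μ) * v =
      ∫⁻ c, ∫⁻ m in closedBall c R, A m ^ (1 / 2 : ℝ) ∂μ ∂μ := by
    have e1 : ∀ c, ∫⁻ m in closedBall c R, A m ^ (1 / 2 : ℝ) ∂μ =
        ∫⁻ m, (closedBall c R).indicator (fun m => A m ^ (1 / 2 : ℝ)) m ∂μ := by
      intro c
      rw [lintegral_indicator measurableSet_closedBall]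
    simp_rw [e1]
    have e2 : ∀ c m, (closedBall c R).indicator (fun m => A m ^ (1 / 2 : ℝ)) m =
        A m ^ (1 / 2 : ℝ) * (closedBall m R).indicator 1 c := by
      intro c m
      by_cases h : m ∈ closedBall c R
      · have h' : c ∈ closedBall m R := by rwa [mem_closedBall_comm]
        simp [Set.indicator, h, h']
      · have h' : c ∉ closedBall m R := by rwa [mem_closedBall_comm]
        simp [Set.indicator, h, h']
    simp_rw [e2]
    rw [lintegral_lintegral_swap]
    · rw [← lintegral_mul_const _ (hAm.pow_const _)]
      congr with m
      rw [lintegral_const_mul _ (measurable_one.indicator measurableSet_closedBall),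
        lintegral_indicator_one measurableSet_closedBall, hvc]
    · apply AEMeasurable.mul
      · exact ((hAm.pow_const _).comp measurable_snd).aemeasurable
      · apply Measurable.aemeasurable
        have : (fun p : E × E => (closedBall p.2 R).indicator (1 : E → ℝ≥0∞) p.1) =
          ({p : E × E | dist p.1 p.2 ≤ R}).indicator 1 := by
          ext p; simp [Set.indicator, mem_closedBall]
        change Measurable (fun p : E × E => _)
        rw [this]
        apply measurable_one.indicator
        exact measurableSet_le (by fun_prop) (by fun_prop)
  -- pointwise bound for each center
  have h2 : ∀ c, ∫⁻ m in closedBall c R, A m ^ (1 / 2 : ℝ) ∂μ ≤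
      v ^ (1 / 2 : ℝ) * ∫⁻ x in closedBall c (2 * R), U x ∂μ := by
    intro c
    have hH := ENNReal.lintegral_mul_le_Lp_mul_Lq (μ.restrict (closedBall c R))
      (p := 2) (q := 2) (Real.HolderConjugate.two_two) (f := fun _ => 1)
      (g := fun m => A m ^ (1 / 2 : ℝ)) aemeasurable_const (hAm.pow_const _).aemeasurable
    have e3 : ∀ m, (A m ^ (1 / 2 : ℝ)) ^ (2 : ℝ) = A m := by
      intro m; rw [← ENNReal.rpow_mul]; norm_num
    simp only [Pi.mul_apply, one_mul, ENNReal.one_rpow, lintegral_const, Measure.restrict_apply_univ,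
      hvc, e3] at hH
    refine hH.trans ?_
    gcongr
    have h3 : ∫⁻ m in closedBall c R, A m ∂μ ≤ (∫⁻ x in closedBall c (2 * R), U x ∂μ) ^ (2 : ℝ) := by
      set U' := (closedBall c (2 * R)).indicator U with hU'
      have hU'm : Measurable U' := hU.indicator measurableSet_closedBall
      calc ∫⁻ m in closedBall c R, A m ∂μ
          ≤ ∫⁻ m in closedBall c R, ∫⁻ z, U' (m + (1 / 2 : ℝ) • z) * U' (m - (1 / 2 : ℝ) • z) ∂μ ∂μ := by
            apply setLIntegral_mono' measurableSet_closedBall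
            intro m hm
            refine le_trans ?_ (setLIntegral_le_lintegral (closedBall 0 R) _)
            apply setLIntegral_mono' measurableSet_closedBall
            intro z hz
            rw [mem_closedBall, dist_eq_norm] at hm
            rw [mem_closedBall_zero_iff] at hz
            have hz2 : ‖(1 / 2 : ℝ) • z‖ ≤ R := by
              rw [norm_smul]; norm_num; linarith
            have i1 : m + (1 / 2 : ℝ) • z ∈ closedBall c (2 * R) := by
              rw [mem_closedBall, dist_eq_norm]
              calc _ = ‖(m - c) + (1 / 2 : ℝ) • z‖ := by congr 1; abel
                _ ≤ _ := norm_add_le _ _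
                _ ≤ _ := by linarith
            have i2 : m - (1 / 2 : ℝ) • z ∈ closedBall c (2 * R) := by
              rw [mem_closedBall, dist_eq_norm]
              calc _ = ‖(m - c) - (1 / 2 : ℝ) • z‖ := by congr 1; abel
                _ ≤ _ := norm_sub_le _ _
                _ ≤ _ := by linarith
            rw [hU', Set.indicator_of_mem i1, Set.indicator_of_mem i2]
        _ ≤ ∫⁻ m, ∫⁻ z, U' (m + (1 / 2 : ℝ) • z) * U' (m - (1 / 2 : ℝ) • z) ∂μ ∂μ :=
            setLIntegral_le_lintegral _ _
        _ = ∫⁻ x, ∫⁻ y, U' x * U' y ∂μ ∂μ :=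
            shear_lintegral μ (fun x y => U' x * U' y)
              ((hU'm.comp measurable_fst).mul (hU'm.comp measurable_snd))
        _ = (∫⁻ x, U' x ∂μ) * ∫⁻ x, U' x ∂μ := by
            simp_rw [lintegral_const_mul _ hU'm, lintegral_mul_const _ hU'm]
        _ = _ := by
            rw [hU', lintegral_indicator measurableSet_closedBall]
            norm_num [sq]
    calc _ ≤ ((∫⁻ x in closedBall c (2 * R), U x ∂μ) ^ (2 : ℝ)) ^ (1 / 2 : ℝ) := by gcongr
      _ = _ := by rw [← ENNReal.rpow_mul]; norm_num
  have h4 : ∫⁻ c, ∫⁻ x in closedBall c (2 * R), U x ∂μ ∂μ =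
      ENNReal.ofReal (2 ^ Module.finrank ℝ E) * v * ∫⁻ x, U x ∂μ := by
    have e1 : ∀ c, ∫⁻ m in closedBall c (2 * R), U m ∂μ =
        ∫⁻ m, U m * (closedBall m (2 * R)).indicator 1 c ∂μ := by
      intro c
      rw [← lintegral_indicator measurableSet_closedBall]
      congr with m
      by_cases h : m ∈ closedBall c (2 * R)
      · have h' : c ∈ closedBall m (2 * R) := by rwa [mem_closedBall_comm]
        simp [Set.indicator, h, h']
      · have h' : c ∉ closedBall m (2 * R) := by rwa [mem_closedBall_comm]
        simp [Set.indicator, h, h']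
    simp_rw [e1]
    rw [lintegral_lintegral_swap]
    · rw [← lintegral_const_mul _ hU]
      congr with m
      rw [lintegral_const_mul _ (measurable_one.indicator measurableSet_closedBall),
        lintegral_indicator_one measurableSet_closedBall, hv2c, mul_comm]
    · apply AEMeasurable.mul
      · exact (hU.comp measurable_snd).aemeasurable
      · apply Measurable.aemeasurable
        have : (fun p : E × E => (closedBall p.2 (2 * R)).indicator (1 : E → ℝ≥0∞) p.1) =
          ({p : E × E | dist p.1 p.2 ≤ 2 * R}).indicator 1 := by
          ext p; simp [Set.indicator, mem_closedBall]
        change Measurable (fun p : E × E => _)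
        rw [this]
        apply measurable_one.indicator
        exact measurableSet_le (by fun_prop) (by fun_prop)
  have h5 : (∫⁻ m, A m ^ (1 / 2 : ℝ) ∂μ) * v ≤
      (ENNReal.ofReal (2 ^ Module.finrank ℝ E) * v ^ (1 / 2 : ℝ) * ∫⁻ x, U x ∂μ) * v := by
    rw [h1]
    calc _ ≤ ∫⁻ c, v ^ (1 / 2 : ℝ) * ∫⁻ x in closedBall c (2 * R), U x ∂μ ∂μ := lintegral_mono h2
      _ = v ^ (1 / 2 : ℝ) * ∫⁻ c, ∫⁻ x in closedBall c (2 * R), U x ∂μ ∂μ := by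
          rw [lintegral_const_mul' _ _ (ENNReal.rpow_ne_top_of_nonneg (by norm_num) hvt)]
      _ = _ := by rw [h4]; ring
  exact (ENNReal.mul_le_mul_iff_left hv0 hvt).1 h5

open Metric in
/-- The main bilinear estimate. -/
lemma kernel_bound (d k : ℕ) (hdim : Module.finrank ℝ E = 2 * d) (hk : d + 1 ≤ k) :
    ∃ C : ℝ≥0∞, C ≠ ⊤ ∧ ∀ (Θ : E → E → ℝ≥0∞) (S : E → ℝ≥0∞) (B : ℝ≥0∞),
      (∀ m, Measurable (Θ m)) → Measurable S →
      (∀ m, ∫⁻ z, (ENNReal.ofReal ((1 + ‖z‖) ^ k) * Θ m z) ^ (2 : ℝ) ∂μ ≤ B ^ (2 : ℝ)) →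
      ∫⁻ m, ∫⁻ z, Θ m z * (S (m + (1 / 2 : ℝ) • z) * S (m - (1 / 2 : ℝ) • z)) ∂μ ∂μ ≤
        C * B * ∫⁻ x, S x ^ (2 : ℝ) ∂μ := by
  set v := μ (closedBall (0 : E) 1) with hv
  have hvt : v ≠ ⊤ := (measure_closedBall_lt_top).ne
  -- weights
  set q : ℕ → ℝ≥0∞ := fun j => ENNReal.ofReal ((2 : ℝ)⁻¹ ^ (j * k)) with hq
  set D : ℝ≥0∞ := ENNReal.ofReal (2 ^ k) with hD
  have hweight : ∀ z : E, 1 ≤ D * ∑' j, q j * ((closedBall (0 : E) (2 ^ j)).indicator 1 z *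
      ENNReal.ofReal ((1 + ‖z‖) ^ k)) := by
    intro z
    obtain ⟨n, hn1, hn2⟩ := exists_nat_pow_near (x := 1 + ‖z‖) (y := 2)
      (by linarith [norm_nonneg z]) (by norm_num)
    have hz : z ∈ closedBall (0 : E) (2 ^ (n + 1)) := by
      rw [mem_closedBall_zero_iff]; linarith
    refine le_trans ?_ (mul_le_mul_right (ENNReal.le_tsum (n + 1)) D)
    rw [Set.indicator_of_mem hz, Pi.one_apply, one_mul, hq, hD, ← ENNReal.ofReal_mul (by positivity),
      ← ENNReal.ofReal_mul (by positivity), ← ENNReal.ofReal_one]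
    apply ENNReal.ofReal_le_ofReal
    calc (1 : ℝ) = 2 ^ k * (2⁻¹ ^ ((n + 1) * k) * (2 ^ n) ^ k) := by
          rw [← pow_mul, add_mul, pow_add, inv_pow, inv_pow, one_mul]
          field_simp
      _ ≤ _ := by gcongr
  refine ⟨D * ∑' j, q j * (ENNReal.ofReal (2 ^ (2 * d)) *
    (ENNReal.ofReal ((2 : ℝ) ^ (j * d)) * v ^ (1 / 2 : ℝ))), ?_, ?_⟩
  · apply ENNReal.mul_ne_top ENNReal.ofReal_ne_top
    have : ∀ j, q j * (ENNReal.ofReal (2 ^ (2 * d)) *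
        (ENNReal.ofReal ((2 : ℝ) ^ (j * d)) * v ^ (1 / 2 : ℝ))) ≤
        (ENNReal.ofReal (2 ^ (2 * d)) * v ^ (1 / 2 : ℝ)) * ENNReal.ofReal ((2 : ℝ)⁻¹ ^ j) := by
      intro j
      calc _ = (ENNReal.ofReal (2 ^ (2 * d)) * v ^ (1 / 2 : ℝ)) *
            (q j * ENNReal.ofReal ((2 : ℝ) ^ (j * d))) := by ring
        _ ≤ _ := by
          gcongr
          rw [hq, ← ENNReal.ofReal_mul (by positivity)]
          apply ENNReal.ofReal_le_ofReal
          obtain ⟨l, rfl⟩ := Nat.exists_eq_add_of_le hk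
          calc (2 : ℝ)⁻¹ ^ (j * (d + 1 + l)) * 2 ^ (j * d)
              = 2⁻¹ ^ j * 2⁻¹ ^ (j * l) := by
                rw [show j * (d + 1 + l) = j * d + j + j * l by ring, pow_add, pow_add]
                rw [inv_pow _ (j * d)]; field_simp
            _ ≤ 2⁻¹ ^ j * 1 := by
                gcongr
                exact pow_le_one₀ (by norm_num) (by norm_num)
            _ = _ := mul_one _
    refine ne_top_of_le_ne_top ?_ (ENNReal.tsum_le_tsum this)
    rw [ENNReal.tsum_mul_left]
    apply ENNReal.mul_ne_top
    · exact ENNReal.mul_ne_top ENNReal.ofReal_ne_top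
        (ENNReal.rpow_ne_top_of_nonneg (by norm_num) hvt)
    · rw [← ENNReal.ofReal_tsum_of_nonneg (fun _ => by positivity)
        (summable_geometric_of_lt_one (by norm_num) (by norm_num))]
      exact ENNReal.ofReal_ne_top
  · intro Θ S B hΘ hS hB
    set U : E → ℝ≥0∞ := fun x => S x ^ (2 : ℝ) with hU
    have hUm : Measurable U := hS.pow_const _
    set A : ℕ → E → ℝ≥0∞ := fun j m =>
      ∫⁻ z in closedBall 0 (2 ^ j), U (m + (1 / 2 : ℝ) • z) * U (m - (1 / 2 : ℝ) • z) ∂μ with hA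
    have hAm : ∀ j, Measurable (A j) := by
      intro j
      apply Measurable.lintegral_prod_right' (f := fun p : E × E => U (p.1 + (1 / 2 : ℝ) • p.2) * U (p.1 - (1 / 2 : ℝ) • p.2))
      exact (hUm.comp (by fun_prop)).mul (hUm.comp (by fun_prop))
    have hinner : ∀ m, ∫⁻ z, Θ m z * (S (m + (1 / 2 : ℝ) • z) * S (m - (1 / 2 : ℝ) • z)) ∂μ ≤
        D * ∑' j, q j * (B * A j m ^ (1 / 2 : ℝ)) := by
      intro m
      set P : E → ℝ≥0∞ := fun z => S (m + (1 / 2 : ℝ) • z) * S (m - (1 / 2 : ℝ) • z) with hP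
      have hPm : Measurable P := (hS.comp (by fun_prop)).mul (hS.comp (by fun_prop))
      set w : E → ℝ≥0∞ := fun z => ENNReal.ofReal ((1 + ‖z‖) ^ k) * Θ m z with hw
      have hwm : Measurable w := by
        refine Measurable.mul ?_ (hΘ m)
        fun_prop
      have hPU : ∀ z, P z ^ (2 : ℝ) = U (m + (1 / 2 : ℝ) • z) * U (m - (1 / 2 : ℝ) • z) := by
        intro z
        rw [hP, hU, ENNReal.mul_rpow_of_nonneg _ _ (by norm_num)]
      have s1 : ∀ z, Θ m z * P z ≤
          D * ∑' j, q j * (closedBall (0 : E) (2 ^ j)).indicator (fun z => w z * P z) z := by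
        intro z
        calc Θ m z * P z = 1 * (Θ m z * P z) := (one_mul _).symm
          _ ≤ (D * ∑' j, q j * ((closedBall (0 : E) (2 ^ j)).indicator 1 z *
                ENNReal.ofReal ((1 + ‖z‖) ^ k))) * (Θ m z * P z) := by gcongr; exact hweight z
          _ = D * ((∑' j, q j * ((closedBall (0 : E) (2 ^ j)).indicator 1 z *
                ENNReal.ofReal ((1 + ‖z‖) ^ k))) * (Θ m z * P z)) := by ring
          _ = _ := by
            rw [← ENNReal.tsum_mul_right]
            congr 2
            ext j
            by_cases h : z ∈ closedBall (0 : E) (2 ^ j)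
            · rw [Set.indicator_of_mem h, Set.indicator_of_mem h, hw]
              simp only [Pi.one_apply]; ring
            · rw [Set.indicator_of_notMem h, Set.indicator_of_notMem h]; simp
      refine (lintegral_mono s1).trans ?_
      have hmeas : ∀ j, Measurable fun z => q j * (closedBall (0 : E) (2 ^ j)).indicator (fun z => w z * P z) z :=
        fun j => ((hwm.mul hPm).indicator measurableSet_closedBall).const_mul _
      rw [lintegral_const_mul _ (Measurable.tsum hmeas), lintegral_tsum (fun j => (hmeas j).aemeasurable)]
      gcongr with j
      have hwP : Measurable (fun z => w z * P z) := hwm.mul hPm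
      rw [lintegral_const_mul _ (hwP.indicator measurableSet_closedBall),
        lintegral_indicator measurableSet_closedBall]
      gcongr
      have hH := ENNReal.lintegral_mul_le_Lp_mul_Lq (μ.restrict (closedBall 0 (2 ^ j)))
        (p := 2) (q := 2) (Real.HolderConjugate.two_two) (f := w) (g := P)
        hwm.aemeasurable hPm.aemeasurable
      simp only [Pi.mul_apply, hPU] at hH
      refine hH.trans ?_
      gcongr
      calc _ ≤ (∫⁻ z, w z ^ (2 : ℝ) ∂μ) ^ (1 / 2 : ℝ) := by
            gcongr; exact Measure.restrict_le_self
        _ ≤ (B ^ (2 : ℝ)) ^ (1 / 2 : ℝ) := by gcongr; exact hB m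
        _ = B := by rw [← ENNReal.rpow_mul]; norm_num
    refine (lintegral_mono hinner).trans ?_
    have hmeas : ∀ j, Measurable fun m => q j * (B * A j m ^ (1 / 2 : ℝ)) :=
      fun j => (((hAm j).pow_const _).const_mul _).const_mul _
    rw [lintegral_const_mul _ (Measurable.tsum hmeas), lintegral_tsum (fun j => (hmeas j).aemeasurable)]
    rw [mul_assoc, mul_assoc]
    gcongr
    rw [← ENNReal.tsum_mul_right]
    refine ENNReal.tsum_le_tsum fun j => ?_
    rw [lintegral_const_mul _ (((hAm j).pow_const _).const_mul _), lintegral_const_mul _ ((hAm j).pow_const _)]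
    have hb := kernel_ball μ U hUm (2 ^ j) (by positivity)
    have hvol : μ (closedBall (0 : E) (2 ^ j)) ^ (1 / 2 : ℝ) =
        ENNReal.ofReal ((2 : ℝ) ^ (j * d)) * v ^ (1 / 2 : ℝ) := by
      have := Measure.addHaar_closedBall_mul μ (0 : E) (r := 2 ^ j) (by positivity) (s := 1) (by norm_num)
      rw [mul_one] at this
      rw [this, ENNReal.mul_rpow_of_nonneg _ _ (by norm_num), hdim]
      congr 1
      rw [ENNReal.ofReal_rpow_of_nonneg (by positivity) (by norm_num)]
      congr 1
      rw [← Real.sqrt_eq_rpow, ← pow_mul, show j * (2 * d) = (j * d) * 2 by ring, pow_mul,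
        Real.sqrt_sq (by positivity)]
    rw [hvol, hdim] at hb
    calc q j * (B * ∫⁻ m, A j m ^ (1 / 2 : ℝ) ∂μ) ≤ q j * (B * (ENNReal.ofReal (2 ^ (2 * d)) *
          (ENNReal.ofReal ((2 : ℝ) ^ (j * d)) * v ^ (1 / 2 : ℝ)) * ∫⁻ x, U x ∂μ)) :=
          mul_le_mul_right (mul_le_mul_right hb B) (q j)
      _ = _ := by ring

end kernel
end WAW

namespace WAW
open SchwartzMap
open scoped Nat ContDiff ENNReal FourierTransform LineDeriv Laplacian

section bbound
variable {E : Type*} [NormedAddCommGroup E] [InnerProductSpace ℝ E] [FiniteDimensional ℝ E]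
  [MeasurableSpace E] [BorelSpace E]

lemma norm_iteratedFDeriv_lineDeriv_le (v : E) (h : 𝓢(E, ℂ)) (j : ℕ) (z : E) :
    ‖iteratedFDeriv ℝ j (∂_{v} h : 𝓢(E, ℂ)) z‖ ≤ ‖v‖ * ‖iteratedFDeriv ℝ (j + 1) h z‖ := by
  have e : (⇑(∂_{v} h : 𝓢(E, ℂ))) = fun x => fderiv ℝ h x v := by
    ext x; exact lineDerivOp_apply_eq_fderiv v h x
  rw [e, ← norm_iteratedFDeriv_fderiv]
  refine norm_iteratedFDeriv_clm_apply_const (N := ∞) ?_ (by exact_mod_cast le_top)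
  exact ((h.smooth ⊤).fderiv_right (m := ∞) (by simp)).contDiffAt

lemma schwartz_iteratedFDeriv_sum {ι : Type*} (s : Finset ι) (f : ι → 𝓢(E, ℂ)) (j : ℕ) (z : E) :
    iteratedFDeriv ℝ j (⇑(∑ i ∈ s, f i)) z = ∑ i ∈ s, iteratedFDeriv ℝ j (f i) z := by
  have e : (⇑(∑ i ∈ s, f i)) = fun x => ∑ i ∈ s, f i x := by
    ext x; simp
  rw [e, iteratedFDeriv_sum]
  · simp
  intro i _
  exact (f i).smooth j

lemma norm_iteratedFDeriv_laplacian_le (h : 𝓢(E, ℂ)) (j : ℕ) (z : E) :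
    ‖iteratedFDeriv ℝ j (Δ h : 𝓢(E, ℂ)) z‖ ≤
      Module.finrank ℝ E * ‖iteratedFDeriv ℝ (j + 2) h z‖ := by
  rw [laplacian_eq_sum (stdOrthonormalBasis ℝ E), schwartz_iteratedFDeriv_sum]
  refine (norm_sum_le _ _).trans ?_
  calc _ ≤ ∑ i : Fin (Module.finrank ℝ E), ‖iteratedFDeriv ℝ (j + 2) h z‖ := by
        apply Finset.sum_le_sum
        intro i _
        refine (norm_iteratedFDeriv_lineDeriv_le _ _ _ _).trans ?_
        rw [OrthonormalBasis.norm_eq_one, one_mul]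
        refine (norm_iteratedFDeriv_lineDeriv_le _ _ _ _).trans ?_
        rw [OrthonormalBasis.norm_eq_one, one_mul]
    _ = _ := by simp

/-- The operator `1 - Δ` on Schwartz functions. -/
def oml (h : 𝓢(E, ℂ)) : 𝓢(E, ℂ) := h - Δ h

lemma norm_iteratedFDeriv_oml_le (h : 𝓢(E, ℂ)) (j : ℕ) (z : E) :
    ‖iteratedFDeriv ℝ j (oml h) z‖ ≤ ‖iteratedFDeriv ℝ j h z‖ +
      Module.finrank ℝ E * ‖iteratedFDeriv ℝ (j + 2) h z‖ := by
  have e : (⇑(oml h)) = (⇑h) - ⇑(Δ h : 𝓢(E, ℂ)) := by ext x; simp [oml]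
  rw [e, iteratedFDeriv_sub_apply (h.smooth j).contDiffAt ((Δ h : 𝓢(E, ℂ)).smooth j).contDiffAt]
  refine (norm_sub_le _ _).trans ?_
  gcongr
  exact norm_iteratedFDeriv_laplacian_le h j z

lemma oml_iter_bound (M : ℕ) : ∃ C : ℝ, 0 ≤ C ∧ ∀ (h : 𝓢(E, ℂ)) (z : E) (G : ℝ),
    (∀ j ≤ 2 * M, ‖iteratedFDeriv ℝ j h z‖ ≤ G) → ‖(oml^[M] h) z‖ ≤ C * G := by
  induction M with
  | zero =>
    refine ⟨1, by norm_num, fun h z G hG => ?_⟩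
    have := hG 0 (by simp)
    simpa using this
  | succ M ih =>
    obtain ⟨C, hC, ih⟩ := ih
    refine ⟨C * (1 + Module.finrank ℝ E), by positivity, fun h z G hG => ?_⟩
    rw [Function.iterate_succ_apply, mul_assoc]
    apply ih
    intro j hj
    refine (norm_iteratedFDeriv_oml_le h j z).trans ?_
    have h1 := hG j (by omega)
    have h2 := hG (j + 2) (by omega)
    rw [add_mul, one_mul]
    gcongr

lemma fourier_oml (h : 𝓢(E, ℂ)) (ξ : E) :
    (𝓕 (oml h) : 𝓢(E, ℂ)) ξ = ((1 + (2 * Real.pi) ^ 2 * ‖ξ‖ ^ 2 : ℝ) : ℂ) * (𝓕 h : 𝓢(E, ℂ)) ξ := by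
  have e : (𝓕 (oml h) : 𝓢(E, ℂ)) = 𝓕 h + (2 * Real.pi) ^ 2 • smulLeftCLM ℂ (fun x : E => ‖x‖ ^ 2) (𝓕 h) := by
    rw [oml, laplacian_eq_fourierMultiplierCLM, neg_smul, sub_neg_eq_add, FourierTransform.fourier_add,
      FourierTransform.fourier_smul, fourierMultiplierCLM_apply, FourierTransform.fourier_fourierInv_eq]
  rw [e, _root_.add_apply, _root_.smul_apply,
    smulLeftCLM_apply_apply (Function.hasTemperateGrowth_norm_sq E)]
  simp only [Complex.real_smul]
  push_cast
  ring

lemma fourier_oml_iter (M : ℕ) (h : 𝓢(E, ℂ)) (ξ : E) :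
    (𝓕 (oml^[M] h) : 𝓢(E, ℂ)) ξ =
      ((1 + (2 * Real.pi) ^ 2 * ‖ξ‖ ^ 2 : ℝ) : ℂ) ^ M * (𝓕 h : 𝓢(E, ℂ)) ξ := by
  induction M with
  | zero => simp
  | succ M ih => rw [Function.iterate_succ_apply', fourier_oml, ih, pow_succ]; ring

lemma weight_le (M : ℕ) (t : ℝ) (ht : 0 ≤ t) :
    (1 + t) ^ (2 * M) ≤ 2 ^ M * (1 + (2 * Real.pi) ^ 2 * t ^ 2) ^ M := by
  rw [pow_mul, ← mul_pow]
  gcongr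
  have : (1 : ℝ) ≤ (2 * Real.pi) ^ 2 := by
    have := Real.pi_gt_three
    nlinarith
  nlinarith [sq_nonneg (1 - t), sq_nonneg t]

/-- Plancherel in lintegral form. -/
lemma plancherel_lintegral (h : 𝓢(E, ℂ)) :
    ∫⁻ ξ, ‖(𝓕 h : 𝓢(E, ℂ)) ξ‖ₑ ^ (2 : ℝ) = ∫⁻ x, ‖h x‖ₑ ^ (2 : ℝ) := by
  have key : ∀ f : 𝓢(E, ℂ), ∫⁻ x, ‖f x‖ₑ ^ (2 : ℝ) = ENNReal.ofReal (∫ x, ‖f x‖ ^ 2) := by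
    intro f
    rw [ofReal_integral_eq_lintegral_ofReal]
    · congr with x
      rw [ENNReal.ofReal_pow (norm_nonneg _), ofReal_norm]
      norm_cast
    · exact (f.memLp 2 volume).integrable_norm_pow (by norm_num)
    · filter_upwards with x
      positivity
  rw [key, key, integral_norm_sq_fourier]

lemma sobolev_bound (M : ℕ) (h : 𝓢(E, ℂ)) :
    ∫⁻ ξ, (ENNReal.ofReal ((1 + ‖ξ‖) ^ (2 * M)) * ‖(𝓕 h : 𝓢(E, ℂ)) ξ‖ₑ) ^ (2 : ℝ) ≤
      (ENNReal.ofReal (2 ^ M)) ^ (2 : ℝ) * ∫⁻ x, ‖(oml^[M] h) x‖ₑ ^ (2 : ℝ) := by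
  rw [← plancherel_lintegral, ← lintegral_const_mul']
  · apply lintegral_mono
    intro ξ
    dsimp only
    rw [← ENNReal.mul_rpow_of_nonneg _ _ (by norm_num)]
    refine ENNReal.rpow_le_rpow ?_ (by norm_num)
    rw [fourier_oml_iter, enorm_mul, ← mul_assoc]
    gcongr
    rw [enorm_pow, ← ofReal_norm, Complex.norm_real,
      Real.norm_of_nonneg (by positivity), ← ENNReal.ofReal_pow (by positivity),
      ← ENNReal.ofReal_mul (by positivity)]
    exact ENNReal.ofReal_le_ofReal (weight_le M _ (norm_nonneg _))
  · exact ENNReal.rpow_ne_top_of_nonneg (by norm_num) ENNReal.ofReal_ne_top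

lemma two_pi_pos' : (0 : ℝ) < 2 * Real.pi := by positivity

/-- window -/
def gw : 𝓢(E, ℝ) := gaussS (2 * Real.pi) two_pi_pos'

/-- the symbol localized by the window centered at `m` -/
def locS (c : 𝓢(E, ℂ)) (m : E) : 𝓢(E, ℂ) :=
  smulLeftCLM ℂ (⇑(compSubConstCLM ℝ m (gw : 𝓢(E, ℝ)))) c

lemma locS_apply (c : 𝓢(E, ℂ)) (m z : E) : locS c m z = (gw (z - m) : ℂ) * c z := by
  rw [locS, smulLeftCLM_apply_apply (compSubConstCLM ℝ m (gw : 𝓢(E, ℝ))).hasTemperateGrowth,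
    compSubConstCLM_apply, Complex.real_smul]

lemma locS_deriv (M : ℕ) (c : 𝓢(E, ℂ)) (K : ℝ) (hK : 0 ≤ K)
    (h : ∀ j ≤ 2 * M, ∀ z, ‖iteratedFDeriv ℝ j c z‖ ≤ K) (m z : E) :
    ∀ j ≤ 2 * M, ‖iteratedFDeriv ℝ j (locS c m) z‖ ≤
      2 ^ (2 * M) * K * ∑ l ∈ range (2 * M + 1), ‖iteratedFDeriv ℝ l (gw : 𝓢(E, ℝ)) (z - m)‖ := by
  intro j hj
  have e : ⇑(locS c m) = fun z => (gw (z - m) : ℝ) • c z := by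
    ext z; rw [locS_apply, Complex.real_smul]
  rw [e]
  have hg : ContDiff ℝ ∞ (fun z : E => (gw : 𝓢(E, ℝ)) (z - m)) :=
    ((gw : 𝓢(E, ℝ)).smooth ⊤).comp (by fun_prop)
  refine (norm_iteratedFDeriv_smul_le (N := ∞) hg (c.smooth ⊤) z (by exact_mod_cast le_top)).trans ?_
  set G := ∑ l ∈ range (2 * M + 1), ‖iteratedFDeriv ℝ l (gw : 𝓢(E, ℝ)) (z - m)‖ with hG
  have hG0 : 0 ≤ G := by positivity
  calc _ ≤ ∑ i ∈ range (j + 1), (j.choose i : ℝ) * G * K := by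
        apply Finset.sum_le_sum
        intro i hi
        rw [Finset.mem_range] at hi
        gcongr
        · rw [iteratedFDeriv_comp_sub]
          exact Finset.single_le_sum (f := fun l => ‖iteratedFDeriv ℝ l (gw : 𝓢(E, ℝ)) (z - m)‖)
            (fun _ _ => norm_nonneg _) (Finset.mem_range.2 (by omega))
        · exact h _ (by omega) z
    _ = 2 ^ j * K * G := by
        rw [← Finset.sum_mul, ← Finset.sum_mul]
        have := Nat.sum_range_choose j
        have h2 : (∑ i ∈ range (j + 1), (j.choose i : ℝ)) = 2 ^ j := by exact_mod_cast this
        rw [h2]; ring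
    _ ≤ _ := by
        gcongr
        norm_num

lemma gw_sum_L2 (n : ℕ) :
    ∫⁻ z, ENNReal.ofReal (∑ l ∈ range n, ‖iteratedFDeriv ℝ l (gw : 𝓢(E, ℝ)) z‖) ^ (2 : ℝ) ≠ ⊤ := by
  set G : E → ℝ := fun z => ∑ l ∈ range n, ‖iteratedFDeriv ℝ l (gw : 𝓢(E, ℝ)) z‖ with hG
  set D : ℝ := ∑ l ∈ range n, SchwartzMap.seminorm ℝ 0 l (gw : 𝓢(E, ℝ))
  have hD : ∀ z, G z ≤ D := fun z =>
    Finset.sum_le_sum fun l _ => norm_iteratedFDeriv_le_seminorm ℝ _ l z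
  have hint : Integrable G := by
    apply integrable_finsetSum
    intro l _
    simpa using integrable_pow_mul_iteratedFDeriv volume (gw : 𝓢(E, ℝ)) 0 l
  have h1 : ∫⁻ z, ENNReal.ofReal (G z) ^ (2 : ℝ) ≤ ENNReal.ofReal D * ∫⁻ z, ENNReal.ofReal (G z) := by
    rw [← lintegral_const_mul' _ _ ENNReal.ofReal_ne_top]
    apply lintegral_mono
    intro z
    simp only [ENNReal.rpow_two, sq]
    gcongr
    exact hD z
  refine ne_top_of_le_ne_top ?_ h1
  apply ENNReal.mul_ne_top ENNReal.ofReal_ne_top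
  exact (Integrable.lintegral_lt_top hint).ne

lemma B_bound (M : ℕ) : ∃ C : ℝ≥0∞, C ≠ ⊤ ∧ ∀ (c : 𝓢(E, ℂ)) (K : ℝ), 0 ≤ K →
    (∀ j ≤ 2 * M, ∀ z, ‖iteratedFDeriv ℝ j c z‖ ≤ K) → ∀ m : E,
    ∫⁻ ξ, (ENNReal.ofReal ((1 + ‖ξ‖) ^ (2 * M)) * ‖(𝓕 (locS c m) : 𝓢(E, ℂ)) ξ‖ₑ) ^ (2 : ℝ) ≤
      (C * ENNReal.ofReal K) ^ (2 : ℝ) := by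
  obtain ⟨C, hC, hL⟩ := oml_iter_bound (E := E) M
  set I := ∫⁻ z, ENNReal.ofReal (∑ l ∈ range (2 * M + 1), ‖iteratedFDeriv ℝ l (gw : 𝓢(E, ℝ)) z‖) ^ (2 : ℝ)
    with hI
  have hIt : I ≠ ⊤ := gw_sum_L2 _
  refine ⟨ENNReal.ofReal (2 ^ M) * (ENNReal.ofReal (C * 2 ^ (2 * M)) * I ^ (1 / 2 : ℝ)), ?_, ?_⟩
  · exact ENNReal.mul_ne_top ENNReal.ofReal_ne_top (ENNReal.mul_ne_top ENNReal.ofReal_ne_top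
      (ENNReal.rpow_ne_top_of_nonneg (by norm_num) hIt))
  intro c K hK hc m
  refine (sobolev_bound M _).trans ?_
  have h1 : ∫⁻ x, ‖(oml^[M] (locS c m)) x‖ₑ ^ (2 : ℝ) ≤
      (ENNReal.ofReal (C * 2 ^ (2 * M) * K)) ^ (2 : ℝ) * I := by
    have e : I = ∫⁻ z, ENNReal.ofReal (∑ l ∈ range (2 * M + 1),
        ‖iteratedFDeriv ℝ l (gw : 𝓢(E, ℝ)) (z - m)‖) ^ (2 : ℝ) := by
      rw [hI]
      exact (lintegral_sub_right_eq_self (fun z => ENNReal.ofReal (∑ l ∈ range (2 * M + 1),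
        ‖iteratedFDeriv ℝ l (gw : 𝓢(E, ℝ)) z‖) ^ (2 : ℝ)) m).symm
    rw [e, ← lintegral_const_mul' _ _ (ENNReal.rpow_ne_top_of_nonneg (by norm_num) ENNReal.ofReal_ne_top)]
    apply lintegral_mono
    intro z
    dsimp only
    rw [← ENNReal.mul_rpow_of_nonneg _ _ (by norm_num)]
    gcongr
    rw [← ENNReal.ofReal_mul (by positivity), ← ofReal_norm]
    apply ENNReal.ofReal_le_ofReal
    refine (hL (locS c m) z _ (locS_deriv M c K hK hc m z)).trans (le_of_eq (by ring))
  calc _ ≤ (ENNReal.ofReal (2 ^ M)) ^ (2 : ℝ) * ((ENNReal.ofReal (C * 2 ^ (2 * M) * K)) ^ (2 : ℝ) * I) := by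
        gcongr
    _ = _ := by
        have hI2 : I = (I ^ (1 / 2 : ℝ)) ^ (2 : ℝ) := by
          rw [← ENNReal.rpow_mul]; norm_num
        conv_lhs => rw [hI2]
        rw [← ENNReal.mul_rpow_of_nonneg _ _ (by norm_num), ← ENNReal.mul_rpow_of_nonneg _ _ (by norm_num)]
        congr 1
        rw [ENNReal.ofReal_mul (by positivity)]
        ring

end bbound
end WAW

namespace WAW
open SchwartzMap
open scoped Nat ContDiff ENNReal FourierTransform LineDeriv Laplacian

section cv
variable {E : Type*} [NormedAddCommGroup E] [InnerProductSpace ℝ E] [FiniteDimensional ℝ E]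
  [MeasurableSpace E] [BorelSpace E]

lemma gw_pos (z : E) : 0 < (gw : 𝓢(E, ℝ)) z := Real.exp_pos _

lemma gw_neg (z : E) : (gw : 𝓢(E, ℝ)) (-z) = gw z := by simp [gw]

lemma gw_le_one (z : E) : (gw : 𝓢(E, ℝ)) z ≤ 1 := by
  rw [gw, gaussS_apply, Real.exp_le_one_iff]
  have : 0 ≤ 2 * Real.pi * ‖z‖ ^ 2 := by positivity
  linarith

lemma fourier_parseval_int (k : 𝓢(E, ℂ)) (w : E → ℂ) (hw : Integrable w) :
    ∫ z, k z * w z = ∫ ξ, (𝓕 k : 𝓢(E, ℂ)) (-ξ) * 𝓕 w ξ := by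
  have h := VectorFourier.integral_fourierIntegral_smul_eq_flip (L := innerₗ E) (μ := volume) (ν := volume)
    Real.continuous_fourierChar continuous_inner ((𝓕⁻ k : 𝓢(E, ℂ)).integrable (μ := volume)) hw
  have e1 : ∀ z, VectorFourier.fourierIntegral Real.fourierChar volume (innerₗ E) (⇑(𝓕⁻ k : 𝓢(E, ℂ))) z = k z := by
    intro z
    have h2 : (𝓕 (𝓕⁻ k : 𝓢(E, ℂ)) : 𝓢(E, ℂ)) = k := FourierTransform.fourier_fourierInv_eq k
    have h3 := congrArg (fun f : 𝓢(E, ℂ) => f z) h2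
    simp only [fourier_coe] at h3
    exact h3
  have e2 : ∀ ξ, VectorFourier.fourierIntegral Real.fourierChar volume (innerₗ E).flip w ξ = 𝓕 w ξ := by
    intro ξ
    rw [flip_innerₗ]
    rfl
  simp only [e1, e2, smul_eq_mul] at h
  rw [h]
  congr with ξ

lemma abstract_cv (d M : ℕ) (hdim : Module.finrank ℝ E = 2 * d) (hM : d + 1 ≤ 2 * M) :
    ∃ C : ℝ≥0∞, C ≠ ⊤ ∧ ∀ (J : E ≃ₗᵢ[ℝ] E) (W : E → ℂ) (S : E → ℝ≥0∞) (c : 𝓢(E, ℂ)) (K : ℝ), 0 ≤ K →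
      (∀ j ≤ 2 * M, ∀ z, ‖iteratedFDeriv ℝ j c z‖ ≤ K) →
      Measurable W → (∃ D, ∀ z, ‖W z‖ ≤ D) → Measurable S →
      (∀ m ξ, ‖𝓕 (fun z => W z * ((gw : 𝓢(E, ℝ)) (z - m) : ℂ)) ξ‖ₑ ≤
        S (m + (1 / 2 : ℝ) • J ξ) * S (m - (1 / 2 : ℝ) • J ξ)) →
      ‖∫ z, c z * W z‖ₑ ≤ C * ENNReal.ofReal K * ∫⁻ x, S x ^ (2 : ℝ) := by
  obtain ⟨C₁, hC₁, hB⟩ := B_bound (E := E) M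
  obtain ⟨C₂, hC₂, hk⟩ := kernel_bound (volume : Measure E) d (2 * M) hdim hM
  have hg2 : Integrable (fun z : E => ((((gw : 𝓢(E, ℝ)) z) ^ 2 : ℝ) : ℂ)) := by
    apply Integrable.ofReal
    exact ((gw : 𝓢(E, ℝ)).memLp 2 volume).integrable_sq
  set κ : ℂ := ∫ z : E, ((((gw : 𝓢(E, ℝ)) z) ^ 2 : ℝ) : ℂ) with hκ
  have hκ0 : κ ≠ 0 := by
    rw [hκ, integral_complex_ofReal]
    norm_cast
    apply ne_of_gt
    rw [integral_pos_iff_support_of_nonneg (fun z => sq_nonneg _)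
      ((gw : 𝓢(E, ℝ)).memLp 2 volume).integrable_sq]
    have : (Function.support fun i : E => (gw : 𝓢(E, ℝ)) i ^ 2) = Set.univ := by
      ext z
      simp [(gw_pos z).ne']
    rw [this]
    exact isOpen_univ.measure_pos _ ⟨0, trivial⟩
  have hκe : ‖κ‖ₑ ≠ 0 := by simpa using hκ0
  have hκt : ‖κ‖ₑ ≠ ⊤ := enorm_ne_top
  refine ⟨‖κ‖ₑ⁻¹ * (C₂ * C₁), ?_, ?_⟩
  · exact ENNReal.mul_ne_top (ENNReal.inv_ne_top.2 hκe) (ENNReal.mul_ne_top hC₂ hC₁)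
  intro J W S c K hK hc hW hWb hS hFS
  obtain ⟨D, hD⟩ := hWb
  have hcW : Integrable (fun z => c z * W z) :=
    (c.integrable (μ := volume)).mul_bdd (c := D) hW.aestronglyMeasurable (Filter.Eventually.of_forall hD)
  have hconv := integral_convolution (ContinuousLinearMap.mul ℂ ℂ) (μ := volume) (ν := volume) hcW hg2
  simp only [ContinuousLinearMap.mul_apply', convolution_def] at hconv
  have hm : ∀ m : E, ∫ z, c z * W z * ((((gw : 𝓢(E, ℝ)) (m - z)) ^ 2 : ℝ) : ℂ) =
      ∫ ξ, (𝓕 (locS c m) : 𝓢(E, ℂ)) (-ξ) * 𝓕 (fun z => W z * ((gw : 𝓢(E, ℝ)) (z - m) : ℂ)) ξ := by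
    intro m
    have hgi : Integrable (fun z : E => ((gw : 𝓢(E, ℝ)) (z - m) : ℂ)) :=
      (((gw : 𝓢(E, ℝ)).integrable (μ := volume)).comp_sub_right m).ofReal
    rw [← fourier_parseval_int]
    · congr with z
      rw [locS_apply, ← gw_neg (m - z), neg_sub]
      push_cast
      ring
    · exact hgi.bdd_mul (c := D) hW.aestronglyMeasurable (Filter.Eventually.of_forall hD)
  have h1 : ‖κ‖ₑ * ‖∫ z, c z * W z‖ₑ ≤ C₂ * (C₁ * ENNReal.ofReal K) * ∫⁻ x, S x ^ (2 : ℝ) := by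
    rw [mul_comm, ← enorm_mul, hκ, ← hconv]
    refine (enorm_integral_le_lintegral_enorm _).trans ?_
    calc _ ≤ ∫⁻ m, ∫⁻ z, ‖(𝓕 (locS c m) : 𝓢(E, ℂ)) (-(J.symm z))‖ₑ *
          (S (m + (1 / 2 : ℝ) • z) * S (m - (1 / 2 : ℝ) • z)) := by
          apply lintegral_mono
          intro m
          dsimp only
          rw [hm]
          refine (enorm_integral_le_lintegral_enorm _).trans ?_
          rw [← J.measurePreserving.lintegral_comp_emb J.toHomeomorph.measurableEmbedding
            (fun z => ‖(𝓕 (locS c m) : 𝓢(E, ℂ)) (-(J.symm z))‖ₑ *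
              (S (m + (1 / 2 : ℝ) • z) * S (m - (1 / 2 : ℝ) • z)))]
          apply lintegral_mono
          intro ξ
          dsimp only
          rw [enorm_mul, J.symm_apply_apply]
          gcongr
          exact hFS m ξ
      _ ≤ _ := by
          apply hk _ _ _ _ hS
          · intro m
            rw [← J.measurePreserving.lintegral_comp_emb J.toHomeomorph.measurableEmbedding]
            simp only [J.symm_apply_apply, J.norm_map]
            refine le_trans (le_of_eq ?_) (hB c K hK hc m)
            rw [← lintegral_neg_eq_self]
            simp
          · intro m
            have : Continuous fun z => (𝓕 (locS c m) : 𝓢(E, ℂ)) (-(J.symm z)) :=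
              (𝓕 (locS c m) : 𝓢(E, ℂ)).continuous.comp (by fun_prop)
            exact this.enorm.measurable
  calc _ = ‖κ‖ₑ⁻¹ * (‖κ‖ₑ * ‖∫ z, c z * W z‖ₑ) := by
        rw [← mul_assoc, ENNReal.inv_mul_cancel hκe hκt, one_mul]
    _ ≤ ‖κ‖ₑ⁻¹ * (C₂ * (C₁ * ENNReal.ofReal K) * ∫⁻ x, S x ^ (2 : ℝ)) := by gcongr
    _ = _ := by ring

end cv
end WAW

namespace WAW
open SchwartzMap
open scoped Nat ContDiff ENNReal FourierTransform LineDeriv Laplacian RealInnerProductSpace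

/-- `e(t) = exp(2π i t)`. -/
def en (t : ℝ) : ℂ := Complex.exp ((2 * Real.pi * t : ℝ) * Complex.I)

lemma norm_en (t : ℝ) : ‖en t‖ = 1 := Complex.norm_exp_ofReal_mul_I _
lemma en_add (s t : ℝ) : en (s + t) = en s * en t := by
  rw [en, en, en, ← Complex.exp_add]; congr 1; push_cast; ring
lemma conj_en (t : ℝ) : (starRingEnd ℂ) (en t) = en (-t) := by
  rw [en, en, ← Complex.exp_conj]; congr 1
  simp only [map_mul, Complex.conj_I, Complex.conj_ofReal]
  push_cast; ring
@[fun_prop] lemma continuous_en : Continuous en := by unfold en; fun_prop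

section wig
variable {Y : Type*} [NormedAddCommGroup Y] [InnerProductSpace ℝ Y] [FiniteDimensional ℝ Y]
  [MeasurableSpace Y] [BorelSpace Y]

lemma fourier_en (f : Y → ℂ) (w : Y) : 𝓕 f w = ∫ v, en (-⟪v, w⟫) * f v := by
  rw [Real.fourier_eq']
  congr with v
  rw [smul_eq_mul, en]
  congr 4
  ring

/-- the Gaussian constant -/
def kap (Y : Type*) [NormedAddCommGroup Y] [InnerProductSpace ℝ Y] : ℂ :=
  (Real.pi / (2 * Real.pi : ℂ)) ^ (Module.finrank ℝ Y / 2 : ℂ)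

lemma norm_kap_le : ‖kap Y‖ ≤ 1 := by
  have e : (Real.pi / (2 * Real.pi : ℂ)) = ((1 / 2 : ℝ) : ℂ) := by
    have : (Real.pi : ℂ) ≠ 0 := by exact_mod_cast Real.pi_ne_zero
    push_cast
    field_simp
  rw [kap, e, Complex.norm_cpow_eq_rpow_re_of_pos (by norm_num)]
  apply Real.rpow_le_one (by norm_num) (by norm_num)
  have : ((Module.finrank ℝ Y : ℂ) / 2) = ((Module.finrank ℝ Y / 2 : ℝ) : ℂ) := by push_cast; rfl
  rw [this, Complex.ofReal_re]
  positivity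

lemma gauss_int (x b : Y) :
    ∫ η : Y, en ⟪x, η⟫ * (Real.exp (-(2 * Real.pi) * ‖η - b‖ ^ 2) : ℂ) =
      kap Y * (en ⟪x, b⟫ * (Real.exp (-(Real.pi / 2) * ‖x‖ ^ 2) : ℂ)) := by
  rw [← integral_add_right_eq_self _ b]
  simp only [add_sub_cancel_right, inner_add_right, en_add]
  have h := GaussianFourier.integral_cexp_neg_mul_sq_norm_add (V := Y) (b := 2 * Real.pi)
    (by simpa using Real.pi_pos) (2 * Real.pi * Complex.I) x
  have e1 : ∀ η : Y, en ⟪x, η⟫ * en ⟪x, b⟫ * (Real.exp (-(2 * Real.pi) * ‖η‖ ^ 2) : ℂ) =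
      en ⟪x, b⟫ * Complex.exp (-(2 * Real.pi) * (‖η‖ : ℂ) ^ 2 + 2 * Real.pi * Complex.I * (⟪x, η⟫ : ℝ)) := by
    intro η
    rw [Complex.exp_add, mul_comm (en _) (en _), mul_assoc, mul_comm (en _) (Complex.ofReal _)]
    congr 2
    · push_cast; rfl
    · rw [en]; congr 1; push_cast; ring
  simp_rw [e1]
  rw [integral_const_mul, h, kap]
  have e2 : (2 * Real.pi * Complex.I : ℂ) ^ 2 * (‖x‖ : ℂ) ^ 2 / (4 * (2 * Real.pi)) =
      ((-(Real.pi / 2) * ‖x‖ ^ 2 : ℝ) : ℂ) := by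
    have : (Real.pi : ℂ) ≠ 0 := by exact_mod_cast Real.pi_ne_zero
    rw [mul_pow, Complex.I_sq]
    push_cast
    field_simp
    ring
  rw [e2, ← Complex.ofReal_exp]
  ring

/-- The change of variables `(u,v) ↦ (u+v/2, u-v/2)`. -/
def shearT : (Y × Y) ≃ₜ (Y × Y) where
  toFun p := (p.1 + (1 / 2 : ℝ) • p.2, p.1 - (1 / 2 : ℝ) • p.2)
  invFun p := ((1 / 2 : ℝ) • (p.1 + p.2), p.1 - p.2)
  left_inv p := by ext <;> simp <;> module
  right_inv p := by ext <;> simp <;> module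
  continuous_toFun := by fun_prop
  continuous_invFun := by fun_prop

lemma shearT_mp : MeasurePreserving (shearT : (Y × Y) ≃ₜ (Y × Y)) := by
  have h1 : MeasurePreserving (fun p : Y × Y => (p.1, p.2 + (1 / 2 : ℝ) • p.1)) := by
    apply (MeasurePreserving.id volume).skew_product (g := fun v u => u + (1 / 2 : ℝ) • v) (by fun_prop)
    exact Filter.Eventually.of_forall fun v => (measurePreserving_add_right volume _).map_eq
  have h2 : MeasurePreserving (fun p : Y × Y => (p.1, p.1 - p.2)) := by
    apply (MeasurePreserving.id volume).skew_product (g := fun x v => x - v) (by fun_prop)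
    exact Filter.Eventually.of_forall fun v => (Measure.measurePreserving_sub_left volume _).map_eq
  have h3 := (h2.comp (Measure.measurePreserving_swap.comp h1)).comp
    (Measure.measurePreserving_swap (μ := (volume : Measure Y)) (ν := (volume : Measure Y)))
  convert! h3 using 1
  ext p
  · simp [shearT]
  · simp [shearT]; module

lemma shearT_integral (F : Y × Y → ℂ) :
    ∫ p : Y × Y, F (p.1 + (1 / 2 : ℝ) • p.2, p.1 - (1 / 2 : ℝ) • p.2) = ∫ p, F p :=
  shearT_mp.integral_comp shearT.measurableEmbedding F

lemma shearT_integrable (F : Y × Y → ℂ) :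
    Integrable (fun p : Y × Y => F (p.1 + (1 / 2 : ℝ) • p.2, p.1 - (1 / 2 : ℝ) • p.2)) ↔ Integrable F :=
  shearT_mp.integrable_comp_emb shearT.measurableEmbedding

lemma triple_swap (Q : Y → Y → Y → ℂ)
    (hQ : Integrable (fun p : (Y × Y) × Y => Q p.1.1 p.1.2 p.2)) :
    ∫ p : Y × Y, ∫ v, Q p.1 v p.2 = ∫ p : Y × Y, ∫ η, Q p.1 p.2 η := by
  have hmp1 := volume_preserving_prodAssoc (α₁ := Y) (β₁ := Y) (γ₁ := Y)
  have hsw : MeasurePreserving (MeasurableEquiv.prodComm : Y × Y ≃ᵐ Y × Y) :=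
    Measure.measurePreserving_swap
  have hmp2 : MeasurePreserving (MeasurableEquiv.prodCongr (MeasurableEquiv.refl Y)
      (MeasurableEquiv.prodComm : Y × Y ≃ᵐ Y × Y)) := (MeasurePreserving.id volume).prod hsw
  set R : ((Y × Y) × Y) ≃ᵐ ((Y × Y) × Y) := (MeasurableEquiv.prodAssoc.trans
    (MeasurableEquiv.prodCongr (MeasurableEquiv.refl Y) MeasurableEquiv.prodComm)).trans
      MeasurableEquiv.prodAssoc.symm with hR
  have hmp : MeasurePreserving R := (hmp1.symm _).comp (hmp2.comp hmp1)
  have e := hmp.integral_comp R.measurableEmbedding (fun p : (Y × Y) × Y => Q p.1.1 p.1.2 p.2)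
  have hi := (hmp.integrable_comp_emb R.measurableEmbedding).2 hQ
  rw [← integral_prod (fun p : (Y × Y) × Y => Q p.1.1 p.1.2 p.2) hQ,
    ← integral_prod (fun p : (Y × Y) × Y => Q p.1.1 p.2 p.1.2) hi]
  exact e

/-- phase space -/
abbrev PE (Y : Type*) := WithLp 2 (Y × Y)

/-- The Wigner-type function. -/
def Wf (ψ : 𝓢(Y, ℂ)) (z : PE Y) : ℂ :=
  ∫ v : Y, (starRingEnd ℂ) (ψ (z.fst + (1 / 2 : ℝ) • v)) * ψ (z.fst - (1 / 2 : ℝ) • v) * en ⟪v, z.snd⟫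

/-- The short-time Fourier transform. -/
def Vf (ψ : 𝓢(Y, ℂ)) (z : PE Y) : ℂ :=
  ∫ x : Y, en (-⟪x, z.snd⟫) * (ψ x * (Real.exp (-Real.pi * ‖x - z.fst‖ ^ 2) : ℂ))

lemma PE_integral (F : PE Y → ℂ) : ∫ z, F z = ∫ p : Y × Y, F (WithLp.toLp 2 p) :=
  ((WithLp.volume_preserving_toLp Y Y).integral_comp
    (MeasurableEquiv.toLp 2 (Y × Y)).measurableEmbedding F).symm

lemma PE_lintegral (F : PE Y → ℝ≥0∞) : ∫⁻ z, F z = ∫⁻ p : Y × Y, F (WithLp.toLp 2 p) :=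
  ((WithLp.volume_preserving_toLp Y Y).lintegral_comp_emb
    (MeasurableEquiv.toLp 2 (Y × Y)).measurableEmbedding F).symm

lemma Wf_measurable (ψ : 𝓢(Y, ℂ)) : Measurable (Wf ψ) := by
  apply StronglyMeasurable.measurable
  unfold Wf
  apply StronglyMeasurable.integral_prod_right' (f := fun p : PE Y × Y =>
    (starRingEnd ℂ) (ψ (p.1.fst + (1 / 2 : ℝ) • p.2)) * ψ (p.1.fst - (1 / 2 : ℝ) • p.2) * en ⟪p.2, p.1.snd⟫)
  apply Continuous.stronglyMeasurable
  have h1 : Continuous fun p : PE Y × Y => p.1.fst := by fun_prop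
  have h2 : Continuous fun p : PE Y × Y => p.1.snd := by fun_prop
  have := ψ.continuous
  fun_prop

lemma Vf_measurable (ψ : 𝓢(Y, ℂ)) : Measurable (Vf ψ) := by
  apply StronglyMeasurable.measurable
  unfold Vf
  apply StronglyMeasurable.integral_prod_right' (f := fun p : PE Y × Y =>
    en (-⟪p.2, p.1.snd⟫) * (ψ p.2 * (Real.exp (-Real.pi * ‖p.2 - p.1.fst‖ ^ 2) : ℂ)))
  apply Continuous.stronglyMeasurable
  have h1 : Continuous fun p : PE Y × Y => p.1.fst := by fun_prop
  have h2 : Continuous fun p : PE Y × Y => p.1.snd := by fun_prop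
  have := ψ.continuous
  fun_prop

lemma schwartz_bdd (ψ : 𝓢(Y, ℂ)) : ∃ D, 0 ≤ D ∧ ∀ x, ‖ψ x‖ ≤ D :=
  ⟨SchwartzMap.seminorm ℝ 0 0 ψ, apply_nonneg _ _, fun x => SchwartzMap.norm_le_seminorm ℝ ψ x⟩

lemma Wf_bdd (ψ : 𝓢(Y, ℂ)) : ∃ D, ∀ z, ‖Wf ψ z‖ ≤ D := by
  obtain ⟨D, hD0, hD⟩ := schwartz_bdd ψ
  have hi : Integrable (fun v : Y => ‖ψ ((1 / 2 : ℝ) • v)‖) :=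
    (ψ.integrable (μ := volume)).norm.comp_smul (by norm_num)
  refine ⟨∫ v : Y, ‖ψ ((1 / 2 : ℝ) • v)‖ * D, fun z => ?_⟩
  have h1 : (∫ v : Y, ‖ψ ((1 / 2 : ℝ) • v)‖ * D) = ∫ v : Y, ‖ψ (z.fst + (1 / 2 : ℝ) • v)‖ * D := by
    rw [← integral_add_left_eq_self _ ((2 : ℝ) • z.fst)]
    congr with v
    congr 3
    module
  rw [h1]
  apply norm_integral_le_of_norm_le
  · have := hi.comp_add_left ((2 : ℝ) • z.fst)
    refine Integrable.mul_const ?_ D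
    convert! this using 4
    module
  · filter_upwards with v
    rw [norm_mul, norm_mul, norm_en, mul_one, RCLike.norm_conj]
    gcongr
    exact hD _

lemma H_integrable (ψ : 𝓢(Y, ℂ)) : Integrable (fun p : Y × Y =>
    (starRingEnd ℂ) (ψ (p.1 + (1 / 2 : ℝ) • p.2)) * ψ (p.1 - (1 / 2 : ℝ) • p.2)) := by
  apply (shearT_integrable (fun p : Y × Y => (starRingEnd ℂ) (ψ p.1) * ψ p.2)).2
  apply Integrable.mul_prod (f := fun x => (starRingEnd ℂ) (ψ x)) (g := ψ)
  · exact (RCLike.conjLIE (K := ℂ)).toContinuousLinearEquiv.toContinuousLinearMap.integrable_comp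
      ((ψ.integrable (μ := volume)))
  · exact ψ.integrable

end wig
end WAW

namespace WAW
open SchwartzMap
open scoped Nat ContDiff ENNReal FourierTransform LineDeriv Laplacian RealInnerProductSpace

section wig
variable {Y : Type*} [NormedAddCommGroup Y] [InnerProductSpace ℝ Y] [FiniteDimensional ℝ Y]
  [MeasurableSpace Y] [BorelSpace Y]

/-- symplectic rotation -/
def Jm : PE Y ≃ₗᵢ[ℝ] PE Y where
  toFun z := WithLp.toLp 2 (z.snd, -z.fst)
  invFun z := WithLp.toLp 2 (-z.snd, z.fst)
  map_add' x y := by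
    apply WithLp.ofLp_injective; ext <;> simp; abel
  map_smul' c x := by apply WithLp.ofLp_injective; ext <;> simp
  left_inv x := by apply WithLp.ofLp_injective; ext <;> simp
  right_inv x := by apply WithLp.ofLp_injective; ext <;> simp
  norm_map' z := by
    simp only [LinearEquiv.coe_mk, LinearMap.coe_mk, AddHom.coe_mk]
    rw [WithLp.prod_norm_eq_of_L2, WithLp.prod_norm_eq_of_L2]
    simp [add_comm]

lemma gw_prod (u η : Y) (m : PE Y) :
    (gw : 𝓢(PE Y, ℝ)) (WithLp.toLp 2 (u, η) - m) =
      Real.exp (-(2 * Real.pi) * ‖u - m.fst‖ ^ 2) * Real.exp (-(2 * Real.pi) * ‖η - m.snd‖ ^ 2) := by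
  rw [gw, gaussS_apply, WithLp.prod_norm_sq_eq_of_L2, ← Real.exp_add]
  simp [mul_add]

lemma conj_Vf (ψ : 𝓢(Y, ℂ)) (z : PE Y) : (starRingEnd ℂ) (Vf ψ z) =
    ∫ x : Y, en ⟪x, z.snd⟫ * ((starRingEnd ℂ) (ψ x) * (Real.exp (-Real.pi * ‖x - z.fst‖ ^ 2) : ℂ)) := by
  rw [Vf, ← integral_conj]
  congr with x
  simp only [map_mul, conj_en, neg_neg, Complex.conj_ofReal]

lemma quad_id (x y a b : Y) (u v : Y) (hx : x = u + (1 / 2 : ℝ) • v) (hy : y = u - (1 / 2 : ℝ) • v) :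
    -(2 * Real.pi) * ‖u - a‖ ^ 2 + -(Real.pi / 2) * ‖v - b‖ ^ 2 =
      -Real.pi * ‖x - (a + (1 / 2 : ℝ) • b)‖ ^ 2 + -Real.pi * ‖y - (a - (1 / 2 : ℝ) • b)‖ ^ 2 := by
  set X' := x - (a + (1 / 2 : ℝ) • b) with hX
  set Y' := y - (a - (1 / 2 : ℝ) • b) with hY
  have e1 : (2 : ℝ) • (u - a) = X' + Y' := by rw [hX, hY, hx, hy]; module
  have e2 : v - b = X' - Y' := by rw [hX, hY, hx, hy]; module
  have h := parallelogram_law_with_norm ℝ X' Y'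
  rw [← e1, ← e2, norm_smul] at h
  norm_num at h
  linear_combination (-(Real.pi / 2)) * h

lemma Wigner_id (ψ : 𝓢(Y, ℂ)) (m ξ : PE Y) :
    𝓕 (fun z => Wf ψ z * ((gw : 𝓢(PE Y, ℝ)) (z - m) : ℂ)) ξ =
      kap Y * en (-⟪ξ.snd, m.snd⟫) * ((starRingEnd ℂ) (Vf ψ (m + (1 / 2 : ℝ) • Jm ξ)) *
        Vf ψ (m - (1 / 2 : ℝ) • Jm ξ)) := by
  set α := ξ.fst with hα
  set β := ξ.snd with hβ
  set m1 := m.fst with hm1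
  set m2 := m.snd with hm2
  set H : Y → Y → ℂ := fun u v =>
    (starRingEnd ℂ) (ψ (u + (1 / 2 : ℝ) • v)) * ψ (u - (1 / 2 : ℝ) • v) with hH
  set Q : Y → Y → Y → ℂ := fun u v η => H u v * ((Real.exp (-(2 * Real.pi) * ‖u - m1‖ ^ 2) : ℂ) *
    en (-⟪u, α⟫)) * (en ⟪v - β, η⟫ * (Real.exp (-(2 * Real.pi) * ‖η - m2‖ ^ 2) : ℂ)) with hQ
  have hψc := ψ.continuous
  have hQi : Integrable (fun p : (Y × Y) × Y => Q p.1.1 p.1.2 p.2) := by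
    have h1 : Integrable (fun p : (Y × Y) × Y => H p.1.1 p.1.2 *
        (Real.exp (-(2 * Real.pi) * ‖p.2 - m2‖ ^ 2) : ℂ)) := by
      apply Integrable.mul_prod (f := fun p : Y × Y => H p.1 p.2)
        (g := fun η => (Real.exp (-(2 * Real.pi) * ‖η - m2‖ ^ 2) : ℂ)) (H_integrable ψ)
      exact (((gw : 𝓢(Y, ℝ)).integrable (μ := volume)).comp_sub_right m2).ofReal
    refine h1.mono (Continuous.aestronglyMeasurable ?_) (Filter.Eventually.of_forall fun p => ?_)
    · simp only [hQ, hH]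
      fun_prop
    · simp only [hQ, norm_mul, norm_en, mul_one, one_mul]
      gcongr
      rw [Complex.norm_real, Real.norm_of_nonneg (Real.exp_pos _).le]
      refine mul_le_of_le_one_right (norm_nonneg _) ?_
      rw [Real.exp_le_one_iff]
      have : 0 ≤ 2 * Real.pi * ‖p.1.1 - m1‖ ^ 2 := by positivity
      linarith
  have hLHS : 𝓕 (fun z => Wf ψ z * ((gw : 𝓢(PE Y, ℝ)) (z - m) : ℂ)) ξ =
      ∫ p : Y × Y, ∫ v, Q p.1 v p.2 := by
    rw [fourier_en, PE_integral]
    congr with p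
    rw [gw_prod, WithLp.prod_inner_apply]
    simp only [Wf, WithLp.toLp_fst, WithLp.toLp_snd]
    rw [← integral_mul_const, ← integral_const_mul]
    congr with v
    simp only [hQ, hH]
    have hs : ⟪v - β, p.2⟫ = ⟪v, p.2⟫ + -⟪p.2, β⟫ := by
      rw [inner_sub_left, real_inner_comm p.2 β]; ring
    rw [neg_add, en_add, hs, en_add]
    change en (-⟪p.1, α⟫) * en (-⟪p.2, β⟫) * _ = _
    rw [← hm1, ← hm2]
    push_cast
    ring
  rw [hLHS, triple_swap Q hQi]
  set A : Y → ℂ := fun x => en ⟪x, m2 - (1 / 2 : ℝ) • α⟫ *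
    ((starRingEnd ℂ) (ψ x) * (Real.exp (-Real.pi * ‖x - (m1 + (1 / 2 : ℝ) • β)‖ ^ 2) : ℂ)) with hA
  set B : Y → ℂ := fun y => en (-⟪y, m2 + (1 / 2 : ℝ) • α⟫) *
    (ψ y * (Real.exp (-Real.pi * ‖y - (m1 - (1 / 2 : ℝ) • β)‖ ^ 2) : ℂ)) with hB
  have hAV : (starRingEnd ℂ) (Vf ψ (m + (1 / 2 : ℝ) • Jm ξ)) = ∫ x, A x := by
    rw [conj_Vf]
    congr with x
    simp [hA, Jm, ← sub_eq_add_neg]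
    rfl
  have hBV : Vf ψ (m - (1 / 2 : ℝ) • Jm ξ) = ∫ x, B x := by
    rw [Vf]
    congr with x
    simp [hB, Jm]
    rfl
  rw [hAV, hBV, ← integral_prod_mul, ← Measure.volume_eq_prod, ← integral_const_mul,
    ← shearT_integral (fun p => kap Y * en (-⟪β, m2⟫) * (A p.1 * B p.2))]
  congr with p
  simp only [hQ]
  rw [integral_const_mul, gauss_int]
  set u := p.1
  set v := p.2
  have hq := quad_id (u + (1 / 2 : ℝ) • v) (u - (1 / 2 : ℝ) • v) m1 β u v rfl rfl
  have hq2 := congrArg (fun t : ℝ => ((Real.exp t : ℝ) : ℂ)) hq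
  simp only [Real.exp_add, Complex.ofReal_mul] at hq2
  have hph : en (-⟪u, α⟫) * en ⟪v - β, m2⟫ = en (-⟪β, m2⟫) *
      (en ⟪u + (1 / 2 : ℝ) • v, m2 - (1 / 2 : ℝ) • α⟫ * en (-⟪u - (1 / 2 : ℝ) • v, m2 + (1 / 2 : ℝ) • α⟫)) := by
    rw [← en_add, ← en_add, ← en_add]
    congr 1
    simp only [inner_add_left, inner_sub_left, inner_add_right, inner_sub_right, inner_smul_left,
      inner_smul_right]
    simp
    ring
  simp only [hA, hB, hH]
  calc _ = kap Y * ((starRingEnd ℂ) (ψ (u + (1 / 2 : ℝ) • v)) * ψ (u - (1 / 2 : ℝ) • v)) *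
        (en (-⟪u, α⟫) * en ⟪v - β, m2⟫) *
        ((Real.exp (-(2 * Real.pi) * ‖u - m1‖ ^ 2) : ℂ) * (Real.exp (-(Real.pi / 2) * ‖v - β‖ ^ 2) : ℂ)) := by
        ring
    _ = _ := by
        rw [hph, hq2]; ring

lemma Wigner_bound (ψ : 𝓢(Y, ℂ)) (m ξ : PE Y) :
    ‖𝓕 (fun z => Wf ψ z * ((gw : 𝓢(PE Y, ℝ)) (z - m) : ℂ)) ξ‖ₑ ≤
      ‖Vf ψ (m + (1 / 2 : ℝ) • Jm ξ)‖ₑ * ‖Vf ψ (m - (1 / 2 : ℝ) • Jm ξ)‖ₑ := by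
  rw [Wigner_id, enorm_mul, enorm_mul, enorm_mul]
  have h1 : ‖kap Y‖ₑ ≤ 1 := by
    rw [← ofReal_norm, ← ENNReal.ofReal_one]; exact ENNReal.ofReal_le_ofReal norm_kap_le
  have h2 : ‖en (-⟪ξ.snd, m.snd⟫)‖ₑ = 1 := by
    rw [← ofReal_norm, norm_en, ENNReal.ofReal_one]
  have h3 : ‖(starRingEnd ℂ) (Vf ψ (m + (1 / 2 : ℝ) • Jm ξ))‖ₑ = ‖Vf ψ (m + (1 / 2 : ℝ) • Jm ξ)‖ₑ := by
    rw [← ofReal_norm, RCLike.norm_conj, ofReal_norm]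
  rw [h2, h3, mul_one]
  exact mul_le_of_le_one_left (by positivity) h1

/-- `ψ` times translated Gaussian -/
def winS (ψ : 𝓢(Y, ℂ)) (q : Y) : 𝓢(Y, ℂ) :=
  smulLeftCLM ℂ (⇑(compSubConstCLM ℝ q (gaussS Real.pi Real.pi_pos : 𝓢(Y, ℝ)))) ψ

lemma winS_apply (ψ : 𝓢(Y, ℂ)) (q x : Y) :
    winS ψ q x = ψ x * (Real.exp (-Real.pi * ‖x - q‖ ^ 2) : ℂ) := by
  rw [winS, smulLeftCLM_apply_apply (compSubConstCLM ℝ q (gaussS Real.pi Real.pi_pos : 𝓢(Y, ℝ))).hasTemperateGrowth,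
    compSubConstCLM_apply, Complex.real_smul, gaussS_apply, mul_comm]

lemma Vf_eq (ψ : 𝓢(Y, ℂ)) (q p : Y) : Vf ψ (WithLp.toLp 2 (q, p)) = (𝓕 (winS ψ q) : 𝓢(Y, ℂ)) p := by
  rw [fourier_coe, fourier_en]
  simp only [Vf, winS_apply, WithLp.toLp_fst, WithLp.toLp_snd]

lemma Vf_L2 : ∃ C : ℝ≥0∞, C ≠ ⊤ ∧ ∀ ψ : 𝓢(Y, ℂ),
    ∫⁻ z, ‖Vf ψ z‖ₑ ^ (2 : ℝ) ≤ C * ∫⁻ x, ‖ψ x‖ₑ ^ (2 : ℝ) := by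
  set g : Y → ℝ≥0∞ := fun x => ENNReal.ofReal (Real.exp (-Real.pi * ‖x‖ ^ 2)) with hg
  have hgm : Measurable g := by rw [hg]; fun_prop
  refine ⟨∫⁻ x, g x, ?_, fun ψ => ?_⟩
  · exact (Integrable.lintegral_lt_top ((gaussS Real.pi Real.pi_pos : 𝓢(Y, ℝ)).integrable (μ := volume))).ne
  rw [PE_lintegral, Measure.volume_eq_prod, lintegral_prod]
  · simp only [Vf_eq]
    simp_rw [plancherel_lintegral]
    calc _ ≤ ∫⁻ q : Y, ∫⁻ x : Y, ‖ψ x‖ₑ ^ (2 : ℝ) * g (q - x) := by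
          apply lintegral_mono; intro q
          apply lintegral_mono; intro x
          dsimp only
          rw [winS_apply, enorm_mul, ENNReal.mul_rpow_of_nonneg _ _ (by norm_num)]
          gcongr
          rw [← ofReal_norm, Complex.norm_real, Real.norm_of_nonneg (Real.exp_pos _).le, hg]
          dsimp only
          rw [norm_sub_rev x q]
          set t := Real.exp (-Real.pi * ‖q - x‖ ^ 2) with ht
          have ht1 : t ≤ 1 := by
            rw [ht, Real.exp_le_one_iff]
            have : 0 ≤ Real.pi * ‖q - x‖ ^ 2 := by positivity
            linarith
          rw [ENNReal.rpow_two, sq]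
          refine mul_le_of_le_one_left (by positivity) ?_
          rw [← ENNReal.ofReal_one]
          exact ENNReal.ofReal_le_ofReal ht1
      _ = ∫⁻ x : Y, ∫⁻ q : Y, ‖ψ x‖ₑ ^ (2 : ℝ) * g (q - x) := by
          apply lintegral_lintegral_swap
          apply AEMeasurable.mul
          · have : Continuous fun p : Y × Y => ψ p.2 := ψ.continuous.comp continuous_snd
            exact (this.enorm.measurable.pow_const _).aemeasurable
          · exact (hgm.comp (measurable_fst.sub measurable_snd)).aemeasurable
      _ = _ := by
          have : ∀ x, ∫⁻ q : Y, ‖ψ x‖ₑ ^ (2 : ℝ) * g (q - x) = (∫⁻ x, g x) * ‖ψ x‖ₑ ^ (2 : ℝ) := by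
            intro x
            rw [lintegral_const_mul' _ _ (ENNReal.rpow_ne_top_of_nonneg (by norm_num) enorm_ne_top),
              lintegral_sub_right_eq_self g x, mul_comm]
          simp_rw [this]
          rw [lintegral_const_mul]
          exact ψ.continuous.enorm.measurable.pow_const _
  · exact (((Vf_measurable ψ).comp (MeasurableEquiv.toLp 2 (Y × Y)).measurable).enorm.pow_const _).aemeasurable

lemma PE_decay (c : 𝓢(PE Y, ℂ)) : ∃ C : ℝ, 0 ≤ C ∧ ∀ u η : Y,
    ‖c (WithLp.toLp 2 (u, η))‖ ≤ C * (1 + ‖η‖) ^ (-((Module.finrank ℝ Y + 1 : ℕ) : ℝ)) := by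
  set k := Module.finrank ℝ Y + 1
  refine ⟨2 ^ k * ((Finset.Iic (k, 0)).sup fun m => SchwartzMap.seminorm ℝ m.1 m.2) c, by positivity, fun u η => ?_⟩
  have h := one_add_le_sup_seminorm_apply (𝕜 := ℝ) (m := (k, 0)) (k := k) (n := 0) le_rfl le_rfl c
    (WithLp.toLp 2 (u, η))
  rw [norm_iteratedFDeriv_zero] at h
  rw [Real.rpow_neg (by positivity), Real.rpow_natCast, ← div_eq_mul_inv, le_div_iff₀ (by positivity)]
  refine le_trans ?_ h
  rw [mul_comm]
  gcongr
  rw [WithLp.prod_norm_eq_of_L2]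
  apply Real.le_sqrt_of_sq_le
  simp

/-- The Weyl quadratic form as a phase space integral. -/
lemma weyl_form (c : 𝓢(PE Y, ℂ)) (ψ : 𝓢(Y, ℂ)) :
    ∫ q : Y, (starRingEnd ℂ) (ψ q) * ∫ y : Y, (∫ p : Y, c (WithLp.toLp 2 ((1 / 2 : ℝ) • (q + y), p)) *
      en ⟪q - y, p⟫) * ψ y = ∫ z, c z * Wf ψ z := by
  obtain ⟨C, hC, hdec⟩ := PE_decay c
  set H : Y → Y → ℂ := fun u v =>
    (starRingEnd ℂ) (ψ (u + (1 / 2 : ℝ) • v)) * ψ (u - (1 / 2 : ℝ) • v) with hH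
  set Q : Y → Y → Y → ℂ := fun u v η => H u v * (c (WithLp.toLp 2 (u, η)) * en ⟪v, η⟫) with hQ
  have hψc := ψ.continuous
  have hcc := c.continuous
  have hQi : Integrable (fun p : (Y × Y) × Y => Q p.1.1 p.1.2 p.2) := by
    have h1 : Integrable (fun p : (Y × Y) × Y => H p.1.1 p.1.2 *
        ((C * (1 + ‖p.2‖) ^ (-((Module.finrank ℝ Y + 1 : ℕ) : ℝ)) : ℝ) : ℂ)) := by
      apply Integrable.mul_prod (f := fun p : Y × Y => H p.1 p.2)
        (g := fun η : Y => ((C * (1 + ‖η‖) ^ (-((Module.finrank ℝ Y + 1 : ℕ) : ℝ)) : ℝ) : ℂ)) (H_integrable ψ)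
      exact ((integrable_one_add_norm (by push_cast; linarith)).const_mul C).ofReal
    refine h1.mono (Continuous.aestronglyMeasurable ?_) (Filter.Eventually.of_forall fun p => ?_)
    · simp only [hQ, hH]
      fun_prop
    · simp only [hQ, norm_mul, norm_en, mul_one]
      gcongr
      rw [Complex.norm_real]
      exact (hdec _ _).trans (le_abs_self _)
  have e1 : ∫ z, c z * Wf ψ z = ∫ p : Y × Y, ∫ v, Q p.1 v p.2 := by
    rw [PE_integral]
    congr with p
    simp only [Wf, WithLp.toLp_fst, WithLp.toLp_snd]
    rw [← integral_const_mul]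
    congr with v
    simp only [hQ, hH]
    ring
  rw [e1, triple_swap Q hQi]
  have hi := hQi.integral_prod_left
  set F : Y × Y → ℂ := fun p => (starRingEnd ℂ) (ψ p.1) * ((∫ η : Y, c (WithLp.toLp 2 ((1 / 2 : ℝ) • (p.1 + p.2), η)) *
      en ⟪p.1 - p.2, η⟫) * ψ p.2) with hF
  have e2 : ∀ p : Y × Y, ∫ η, Q p.1 p.2 η = F (p.1 + (1 / 2 : ℝ) • p.2, p.1 - (1 / 2 : ℝ) • p.2) := by
    intro p
    simp only [hQ, hF]
    rw [integral_const_mul]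
    have a1 : (1 / 2 : ℝ) • (p.1 + (1 / 2 : ℝ) • p.2 + (p.1 - (1 / 2 : ℝ) • p.2)) = p.1 := by module
    have a2 : (p.1 + (1 / 2 : ℝ) • p.2 - (p.1 - (1 / 2 : ℝ) • p.2)) = p.2 := by module
    rw [a1, a2]
    simp only [hH]; ring
  simp_rw [e2] at hi ⊢
  rw [shearT_integral F, Measure.volume_eq_prod, integral_prod F ((shearT_integrable F).1 hi)]
  congr with q
  rw [← integral_const_mul]

/-- Calderon-Vaillancourt bound for the unscaled form. -/
lemma cv_form (d M : ℕ) (hdim : Module.finrank ℝ Y = d) (hM : d + 1 ≤ 2 * M) :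
    ∃ C : ℝ≥0∞, C ≠ ⊤ ∧ ∀ (c : 𝓢(PE Y, ℂ)) (K : ℝ) (ψ : 𝓢(Y, ℂ)), 0 ≤ K →
      (∀ j ≤ 2 * M, ∀ z, ‖iteratedFDeriv ℝ j c z‖ ≤ K) →
      ‖∫ q : Y, (starRingEnd ℂ) (ψ q) * ∫ y : Y, (∫ p : Y, c (WithLp.toLp 2 ((1 / 2 : ℝ) • (q + y), p)) *
        en ⟪q - y, p⟫) * ψ y‖ₑ ≤ C * ENNReal.ofReal K * ∫⁻ x, ‖ψ x‖ₑ ^ (2 : ℝ) := by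
  have hd2 : Module.finrank ℝ (PE Y) = 2 * d := by
    rw [(WithLp.linearEquiv 2 ℝ (Y × Y)).finrank_eq, Module.finrank_prod, hdim]; ring
  obtain ⟨C₁, hC₁, h1⟩ := abstract_cv (E := PE Y) d M hd2 hM
  obtain ⟨C₂, hC₂, h2⟩ := Vf_L2 (Y := Y)
  refine ⟨C₁ * C₂, ENNReal.mul_ne_top hC₁ hC₂, fun c K ψ hK hc => ?_⟩
  rw [weyl_form]
  refine (h1 Jm (Wf ψ) (fun z => ‖Vf ψ z‖ₑ) c K hK hc (Wf_measurable ψ) (Wf_bdd ψ)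
    (Vf_measurable ψ).enorm (Wigner_bound ψ)).trans ?_
  calc _ ≤ C₁ * ENNReal.ofReal K * (C₂ * ∫⁻ x, ‖ψ x‖ₑ ^ (2 : ℝ)) := by gcongr; exact h2 ψ
    _ = _ := by ring

end wig
end WAW

namespace WAW
open SchwartzMap
open scoped Nat ContDiff ENNReal FourierTransform LineDeriv Laplacian RealInnerProductSpace

abbrev EY (d : ℕ) := EuclideanSpace ℝ (Fin d)

lemma sc_int {F : Type*} [NormedAddCommGroup F] [NormedSpace ℝ F] {d : ℕ} (lam : ℝ) (hl : 0 < lam)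
    (f : (Fin d → ℝ) → F) :
    ∫ x, f x = (lam ^ d : ℝ) • ∫ y : EY d, f (lam • WithLp.ofLp y) := by
  have h1 := (EuclideanSpace.volume_preserving_symm_measurableEquiv_toLp (Fin d)).integral_comp
    (MeasurableEquiv.measurableEmbedding _) (fun x => f (lam • x))
  have h2 := Measure.integral_comp_smul (volume : Measure (Fin d → ℝ)) f lam
  rw [Module.finrank_fin_fun] at h2
  have h3 : ∫ y : EY d, f (lam • WithLp.ofLp y) = ∫ x : Fin d → ℝ, f (lam • x) := h1
  rw [h3, h2, smul_smul, abs_of_pos (by positivity), mul_inv_cancel₀ (by positivity), one_smul]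

/-- scaling equivalence -/
def scE (E : Type*) [NormedAddCommGroup E] [NormedSpace ℝ E] (lam : ℝ) (hl : lam ≠ 0) : E ≃L[ℝ] E :=
  ContinuousLinearEquiv.smulLeft (Units.mk0 lam hl)

lemma scE_apply {E : Type*} [NormedAddCommGroup E] [NormedSpace ℝ E] (lam : ℝ) (hl : lam ≠ 0) (x : E) :
  scE E lam hl x = lam • x := rfl

lemma iteratedFDeriv_sc {E : Type*} [NormedAddCommGroup E] [NormedSpace ℝ E] (c : E → ℂ)
    (hc : ContDiff ℝ ∞ c) (lam : ℝ) (j : ℕ) (z : E) :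
    ‖iteratedFDeriv ℝ j (fun z => c (lam • z)) z‖ ≤ |lam| ^ j * ‖iteratedFDeriv ℝ j c (lam • z)‖ := by
  rw [iteratedFDeriv_comp_const_smul lam (hc.of_le (by exact_mod_cast le_top)), norm_smul, norm_pow, Real.norm_eq_abs]

lemma exp_en (ε : ℝ) (hε : 0 < ε) {d : ℕ} (q y p : EY d) (lam : ℝ) (hl : lam ^ 2 = 2 * Real.pi * ε) :
    Complex.exp (Complex.I * ((∑ i, ((lam • WithLp.ofLp q) i - (lam • WithLp.ofLp y) i) *
      (lam • WithLp.ofLp p) i : ℝ) : ℂ) / ε) = en ⟪q - y, p⟫ := by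
  rw [en]
  congr 1
  have : (∑ i, ((lam • WithLp.ofLp q) i - (lam • WithLp.ofLp y) i) *
      (lam • WithLp.ofLp p) i : ℝ) = lam ^ 2 * ⟪q - y, p⟫ := by
    rw [PiLp.inner_apply, Finset.mul_sum]
    refine Finset.sum_congr rfl fun i _ => ?_
    simp
    ring
  rw [this, hl]
  have : (ε : ℂ) ≠ 0 := by exact_mod_cast hε.ne'
  push_cast
  field_simp

/-- pack -/
def pk {d : ℕ} (z : PS d) : PE (EY d) := WithLp.toLp 2 (WithLp.toLp 2 z.1, WithLp.toLp 2 z.2)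

lemma weyl_scaled {d : ℕ} (ε lam : ℝ) (hε : 0 < ε) (hl0 : 0 < lam) (hl : lam ^ 2 = 2 * Real.pi * ε)
    (c : PE (EY d) → ℂ) (ψ : (Fin d → ℝ) → ℂ) :
    ∫ q : Fin d → ℝ, (starRingEnd ℂ) (ψ q) * weylOp ε (fun z => c (pk z)) ψ q =
      (lam ^ d : ℝ) • ∫ q : EY d, (starRingEnd ℂ) (ψ (lam • WithLp.ofLp q)) * ∫ y : EY d,
        (∫ p : EY d, c (lam • WithLp.toLp 2 ((1 / 2 : ℝ) • (q + y), p)) * en ⟪q - y, p⟫) *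
          ψ (lam • WithLp.ofLp y) := by
  rw [sc_int lam hl0]
  congr 1
  refine integral_congr_ae (Filter.Eventually.of_forall fun q => ?_)
  simp only
  congr 1
  rw [weylOp, sc_int lam hl0, smul_smul]
  have e1 : ∀ y : EY d, (∫ p : Fin d → ℝ, c (pk (fun i => ((lam • WithLp.ofLp q) i + (lam • WithLp.ofLp y) i) / 2, p)) *
      Complex.exp (Complex.I * ((∑ i, ((lam • WithLp.ofLp q) i - (lam • WithLp.ofLp y) i) *
      p i : ℝ) : ℂ) / ε)) * ψ (lam • WithLp.ofLp y) = (lam ^ d : ℝ) • ((∫ p : EY d, c (lam • WithLp.toLp 2 ((1 / 2 : ℝ) • (q + y), p)) * en ⟪q - y, p⟫) *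
          ψ (lam • WithLp.ofLp y)) := by
    intro y
    rw [sc_int lam hl0, smul_mul_assoc]
    congr 3
    ext p
    rw [exp_en ε hε q y p lam hl]
    congr 2
    apply WithLp.ofLp_injective
    refine Prod.ext ?_ rfl
    apply WithLp.ofLp_injective
    ext i
    simp [pk]
    ring
  simp only [] at e1 ⊢
  push_cast at e1 ⊢
  simp_rw [e1]
  have e2 := integral_const_mul (μ := (volume : Measure (EY d))) ((lam : ℂ) ^ d)
    (fun y : EY d => (∫ p : EY d, c (lam • WithLp.toLp 2 ((1 / 2 : ℝ) • (q + y), p)) * en ⟪q - y, p⟫) *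
          ψ (lam • WithLp.ofLp y))

  have hlc : (lam : ℂ) ^ 2 = 2 * Real.pi * ε := by exact_mod_cast hl
  have hlc0 : (lam : ℂ) ≠ 0 := by exact_mod_cast hl0.ne'
  simp only [Complex.real_smul, smul_eq_mul] at *
  push_cast at *
  rw [e2, ← hlc]
  field_simp
  rw [← pow_mul, ← pow_mul, mul_comm d 2]

lemma weyl_bound (d M : ℕ) (hM : d + 1 ≤ 2 * M) :
    ∃ C : ℝ, 0 ≤ C ∧ ∀ (c : 𝓢(PE (EY d), ℂ)) (K ε : ℝ) (ψ : 𝓢(Fin d → ℝ, ℂ)), 0 ≤ K → 0 < ε → ε ≤ 1 →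
      (∀ j ≤ 2 * M, ∀ z, ‖iteratedFDeriv ℝ j c z‖ ≤ K) →
      ‖∫ q : Fin d → ℝ, (starRingEnd ℂ) (ψ q) * weylOp ε (fun z => c (pk z)) ψ q‖ ≤
        C * K * ∫ x, ‖ψ x‖ ^ 2 := by
  obtain ⟨C, hC, h⟩ := cv_form (Y := EY d) d M (by simp) hM
  refine ⟨C.toReal * 3 ^ (2 * M), by positivity, fun c K ε ψ hK hε hε1 hc => ?_⟩
  set lam := Real.sqrt (2 * Real.pi * ε) with hlam
  have hl : lam ^ 2 = 2 * Real.pi * ε := Real.sq_sqrt (by positivity)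
  have hl0 : 0 < lam := Real.sqrt_pos.2 (by positivity)
  have hl3 : lam ≤ 3 := by
    have := Real.pi_lt_d2
    nlinarith [Real.pi_pos]
  rw [weyl_scaled ε lam hε hl0 hl]
  set c' : 𝓢(PE (EY d), ℂ) := compCLMOfContinuousLinearEquiv ℝ (scE _ lam hl0.ne') c with hc'
  set ψ' : 𝓢(EY d, ℂ) := compCLMOfContinuousLinearEquiv ℝ
    ((scE _ lam hl0.ne').trans (EuclideanSpace.equiv (Fin d) ℝ)) ψ with hψ'
  have hb := h c' (3 ^ (2 * M) * K) ψ' (by positivity) (fun j hj z => by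
    refine (iteratedFDeriv_sc c (c.smooth _) lam j z).trans ?_
    gcongr
    · rw [abs_of_pos hl0]
      calc lam ^ j ≤ 3 ^ j := by gcongr
        _ ≤ 3 ^ (2 * M) := by gcongr; norm_num
    · exact hc j hj _)
  have hψi : ∫⁻ x, ‖ψ' x‖ₑ ^ (2 : ℝ) = ENNReal.ofReal (∫ x, ‖ψ' x‖ ^ 2) := by
    rw [ofReal_integral_eq_lintegral_ofReal]
    · congr with x
      rw [← ofReal_norm, ENNReal.ofReal_rpow_of_nonneg (norm_nonneg _) (by norm_num)]
      norm_num
    · have := (memLp_two_iff_integrable_sq_norm ψ'.continuous.aestronglyMeasurable).1 (ψ'.memLp 2 volume)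
      exact this
    · exact Filter.Eventually.of_forall fun x => by positivity
  rw [hψi, ← ENNReal.ofReal_toReal hC, ← ENNReal.ofReal_mul (by positivity), ← ENNReal.ofReal_mul (by positivity),
    ← ofReal_norm, ENNReal.ofReal_le_ofReal_iff (by positivity)] at hb
  rw [norm_smul, Real.norm_of_nonneg (by positivity), sc_int lam hl0 (fun x => ‖ψ x‖ ^ 2)]
  calc _ ≤ lam ^ d * _ := mul_le_mul_of_nonneg_left hb (by positivity)
    _ = _ := by
      simp only [smul_eq_mul]
      have : (∫ x, ‖ψ' x‖ ^ 2) = ∫ y : EY d, ‖ψ (lam • WithLp.ofLp y)‖ ^ 2 := rfl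
      rw [this]
      ring

end WAW

namespace WAW
open SchwartzMap
open scoped Nat ContDiff ENNReal FourierTransform LineDeriv Laplacian RealInnerProductSpace

section heat
variable {E : Type*} [NormedAddCommGroup E] [InnerProductSpace ℝ E] [FiniteDimensional ℝ E]
  [MeasurableSpace E] [BorelSpace E]

lemma fourier_inj {f g : 𝓢(E, ℂ)} (h : ∀ ξ, (𝓕 f : 𝓢(E, ℂ)) ξ = (𝓕 g : 𝓢(E, ℂ)) ξ) : f = g := by
  have : (𝓕 f : 𝓢(E, ℂ)) = 𝓕 g := by ext ξ; exact h ξ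
  rw [← FourierTransform.fourierInv_fourier_eq (F := 𝓢(E, ℂ)) f, this, FourierTransform.fourierInv_fourier_eq]

lemma fourier_lap (h : 𝓢(E, ℂ)) (ξ : E) :
    (𝓕 (Δ h : 𝓢(E, ℂ)) : 𝓢(E, ℂ)) ξ = -(((2 * Real.pi) ^ 2 * ‖ξ‖ ^ 2 : ℝ) : ℂ) * (𝓕 h : 𝓢(E, ℂ)) ξ := by
  have h1 := fourier_oml h ξ
  rw [oml, sub_eq_add_neg, FourierTransform.fourier_add] at h1
  have e2 : (𝓕 (-(Δ h : 𝓢(E, ℂ))) : 𝓢(E, ℂ)) = -𝓕 (Δ h : 𝓢(E, ℂ)) := by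
    exact map_neg (FourierTransform.fourierCLM ℂ 𝓢(E, ℂ)) (Δ h : 𝓢(E, ℂ))
  rw [e2, _root_.add_apply, _root_.neg_apply] at h1
  push_cast at h1 ⊢
  linear_combination -h1

lemma fourier_lap_iter (k : ℕ) (h : 𝓢(E, ℂ)) (ξ : E) :
    (𝓕 ((fun f : 𝓢(E, ℂ) => (Δ f : 𝓢(E, ℂ)))^[k] h) : 𝓢(E, ℂ)) ξ =
      (-(((2 * Real.pi) ^ 2 * ‖ξ‖ ^ 2 : ℝ) : ℂ)) ^ k * (𝓕 h : 𝓢(E, ℂ)) ξ := by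
  induction k with
  | zero => simp
  | succ k ih => rw [Function.iterate_succ_apply', fourier_lap, ih]; ring

lemma fourier_ld (v : E) (h : 𝓢(E, ℂ)) (ξ : E) :
    (𝓕 (∂_{v} h : 𝓢(E, ℂ)) : 𝓢(E, ℂ)) ξ = (2 * Real.pi * Complex.I * ⟪ξ, v⟫) * (𝓕 h : 𝓢(E, ℂ)) ξ := by
  rw [lineDeriv_eq_fourierMultiplierCLM, FourierTransform.fourier_smul, fourierMultiplierCLM_apply,
    FourierTransform.fourier_fourierInv_eq, _root_.smul_apply, smulLeftCLM_apply_apply (by fun_prop)]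
  simp [mul_assoc]

lemma fpos {s : ℝ} (hs : 0 < s) : 0 < (2 * Real.pi) ^ 2 * s := by positivity

/-- heat semigroup -/
def heat (s : ℝ) (hs : 0 < s) (h : 𝓢(E, ℂ)) : 𝓢(E, ℂ) :=
  𝓕⁻ (smulLeftCLM ℂ (⇑(gaussS ((2 * Real.pi) ^ 2 * s) (fpos hs) : 𝓢(E, ℝ))) (𝓕 h))

lemma fourier_heat (s : ℝ) (hs : 0 < s) (h : 𝓢(E, ℂ)) (ξ : E) :
    (𝓕 (heat s hs h) : 𝓢(E, ℂ)) ξ =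
      (Real.exp (-(s * ((2 * Real.pi) ^ 2 * ‖ξ‖ ^ 2))) : ℂ) * (𝓕 h : 𝓢(E, ℂ)) ξ := by
  rw [heat, FourierTransform.fourier_fourierInv_eq, smulLeftCLM_apply_apply (gaussS _ (fpos hs)).hasTemperateGrowth,
    gaussS_apply, Complex.real_smul]
  congr 4
  ring

lemma inv_en (h : 𝓢(E, ℂ)) (z : E) : h z = ∫ ξ, en ⟪ξ, z⟫ * (𝓕 h : 𝓢(E, ℂ)) ξ := by
  conv_lhs => rw [← FourierTransform.fourierInv_fourier_eq (F := 𝓢(E, ℂ)) h]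
  rw [fourierInv_coe, Real.fourierInv_eq']
  congr with ξ

lemma integral_four (h : 𝓢(E, ℂ)) (w : E → ℂ) (hw : Integrable w) :
    ∫ ξ, (𝓕 h : 𝓢(E, ℂ)) ξ * w ξ = ∫ z, h z * 𝓕 w z := by
  have h := VectorFourier.integral_fourierIntegral_smul_eq_flip (L := innerₗ E) (μ := volume) (ν := volume)
    Real.continuous_fourierChar continuous_inner (h.integrable (μ := volume)) hw
  simp only [flip_innerₗ, smul_eq_mul] at h
  exact h

lemma heat_apply (s : ℝ) (hs : 0 < s) (h : 𝓢(E, ℂ)) (z : E) (d : ℕ) (hd : Module.finrank ℝ E = 2 * d) :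
    heat s hs h z = ∫ w, ((((Real.pi * (4 * s)) ^ d)⁻¹ * Real.exp (-‖w‖ ^ 2 / (4 * s)) : ℝ) : ℂ) * h (z - w) := by
  rw [inv_en]
  simp_rw [fourier_heat]
  set b : ℝ := (2 * Real.pi) ^ 2 * s with hb
  have hb0 : 0 < b := fpos hs
  have e1 : ∀ ξ : E, en ⟪ξ, z⟫ * ((Real.exp (-(s * ((2 * Real.pi) ^ 2 * ‖ξ‖ ^ 2))) : ℂ) * (𝓕 h : 𝓢(E, ℂ)) ξ) =
     (𝓕 h : 𝓢(E, ℂ)) ξ * Complex.exp (-(b : ℂ) * ‖ξ‖ ^ 2 + 2 * Real.pi * Complex.I * ⟪z, ξ⟫) := by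
    intro ξ
    have h1 : Complex.exp (-(b : ℂ) * ‖ξ‖ ^ 2) = (Real.exp (-(s * ((2 * Real.pi) ^ 2 * ‖ξ‖ ^ 2))) : ℂ) := by
      rw [Complex.ofReal_exp]; congr 1; rw [hb]; push_cast; ring
    have h2 : Complex.exp (2 * Real.pi * Complex.I * ⟪z, ξ⟫) = en ⟪ξ, z⟫ := by
      rw [en, real_inner_comm]; congr 1; push_cast; ring
    rw [Complex.exp_add, h1, h2]
    ring
  simp_rw [e1]
  rw [integral_four]
  · simp_rw [fourier_gaussian_innerProductSpace' (b := (b : ℂ)) (by simpa using hb0) z]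
    rw [← integral_sub_left_eq_self _ volume z]
    congr with w
    rw [hd, mul_comm]
    have : ((2 * d : ℕ) : ℂ) / 2 = (d : ℕ) := by push_cast; ring
    rw [this, Complex.cpow_natCast]
    have h1 : (Real.pi : ℂ) / b = (((Real.pi * (4 * s)))⁻¹ : ℝ) := by
      rw [← Complex.ofReal_div]; congr 1; rw [hb]
      field_simp
      norm_num
    have h2 : (-(Real.pi : ℂ) ^ 2 * ‖z - (z - w)‖ ^ 2 / b) = ((-‖w‖ ^ 2 / (4 * s) : ℝ) : ℂ) := by
      rw [sub_sub_cancel, hb]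
      push_cast
      have : (s : ℂ) ≠ 0 := by exact_mod_cast hs.ne'
      have : (Real.pi : ℂ) ≠ 0 := by exact_mod_cast Real.pi_ne_zero
      field_simp
      try norm_num
    rw [h1, h2]
    push_cast
    rw [inv_pow]
  · exact GaussianFourier.integrable_cexp_neg_mul_sq_norm_add (by simpa using hb0) _ z

lemma heat_bound (s : ℝ) (hs : 0 < s) (h : 𝓢(E, ℂ)) (z : E) (d : ℕ) (hd : Module.finrank ℝ E = 2 * d)
    (S : ℝ) (hS : ∀ z, ‖h z‖ ≤ S) : ‖heat s hs h z‖ ≤ S := by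
  rw [heat_apply s hs h z d hd]
  have hb : (0 : ℝ) < 1 / (4 * s) := by positivity
  have hg : ∀ w : E, Real.exp (-‖w‖ ^ 2 / (4 * s)) = Real.exp (-(1 / (4 * s)) * ‖w‖ ^ 2) := by
    intro w; congr 1; ring
  have hi : Integrable (fun w : E => S * (((Real.pi * (4 * s)) ^ d)⁻¹ * Real.exp (-‖w‖ ^ 2 / (4 * s)))) := by
    simp_rw [hg]
    exact (((gaussS _ hb : 𝓢(E, ℝ)).integrable (μ := volume)).const_mul _).const_mul _
  refine (norm_integral_le_of_norm_le hi (Filter.Eventually.of_forall fun w => ?_)).trans ?_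
  · rw [norm_mul, mul_comm, Complex.norm_real, Real.norm_of_nonneg (by positivity)]
    gcongr
    exact hS _
  · simp_rw [hg]
    rw [integral_const_mul, integral_const_mul, GaussianFourier.integral_rexp_neg_mul_sq_norm hb, hd]
    have : ((2 * d : ℕ) : ℝ) / 2 = (d : ℕ) := by push_cast; ring
    rw [this, Real.rpow_natCast]
    have : Real.pi / (1 / (4 * s)) = Real.pi * (4 * s) := by field_simp
    rw [this, inv_mul_cancel₀ (by positivity), mul_one]


/-- iterated Laplacian -/
def lapI (k : ℕ) (h : 𝓢(E, ℂ)) : 𝓢(E, ℂ) := (fun f : 𝓢(E, ℂ) => (Δ f : 𝓢(E, ℂ)))^[k] h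

/-- unnormalised remainder -/
def Rm (N : ℕ) (s : ℝ) (hs : 0 < s) (h : 𝓢(E, ℂ)) : 𝓢(E, ℂ) :=
  h - heat s hs (∑ k ∈ range N, (((k ! : ℝ)⁻¹ * (-s) ^ k : ℝ) : ℂ) • lapI k h)

/-- scalar remainder -/
def phiN (N : ℕ) (x : ℝ) : ℝ := 1 - Real.exp (-x) * ∑ k ∈ range N, (k ! : ℝ)⁻¹ * x ^ k

lemma phiN_deriv (N : ℕ) (x : ℝ) :
    HasDerivAt (phiN (N + 1)) (Real.exp (-x) * ((N ! : ℝ)⁻¹ * x ^ N)) x := by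
  induction N with
  | zero =>
    have : HasDerivAt (fun x : ℝ => 1 - Real.exp (-x)) (Real.exp (-x)) x := by
      have := ((hasDerivAt_neg x).exp).const_sub 1
      simpa using this
    convert this using 1
    · ext x; simp [phiN]
    · simp
  | succ n ih =>
    have e : phiN (n + 1 + 1) = fun x => phiN (n + 1) x - Real.exp (-x) * (((n + 1) ! : ℝ)⁻¹ * x ^ (n + 1)) := by
      ext x
      simp only [phiN]
      rw [Finset.sum_range_succ _ (n + 1)]
      ring
    rw [e]
    have h1 := (((hasDerivAt_neg x).exp).mul ((hasDerivAt_pow (n + 1) x).const_mul (((n + 1) ! : ℝ)⁻¹)))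
    refine HasDerivAt.congr_deriv (ih.sub h1) ?_
    have : ((n + 1) ! : ℝ) = (n + 1) * n ! := by rw [Nat.factorial_succ]; push_cast; ring
    rw [this]
    have : (n ! : ℝ) ≠ 0 := by positivity
    push_cast
    field_simp
    simp

lemma phiN_bd (N : ℕ) (x : ℝ) (hx : 0 ≤ x) : |phiN N x| ≤ 1 := by
  have h0 : 0 ≤ ∑ k ∈ range N, (k ! : ℝ)⁻¹ * x ^ k := by positivity
  have h1 : ∑ k ∈ range N, (k ! : ℝ)⁻¹ * x ^ k ≤ Real.exp x := by
    refine le_trans (le_of_eq ?_) (Real.sum_le_exp_of_nonneg hx N)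
    exact Finset.sum_congr rfl fun k _ => by rw [div_eq_inv_mul]
  have h2 : Real.exp (-x) * ∑ k ∈ range N, (k ! : ℝ)⁻¹ * x ^ k ≤ Real.exp (-x) * Real.exp x := by gcongr
  rw [← Real.exp_add] at h2
  simp at h2
  have h3 : 0 ≤ Real.exp (-x) * ∑ k ∈ range N, (k ! : ℝ)⁻¹ * x ^ k := by positivity
  rw [abs_le, phiN]
  constructor <;> linarith

lemma fourier_Rm (N : ℕ) (s : ℝ) (hs : 0 < s) (h : 𝓢(E, ℂ)) (ξ : E) :
    (𝓕 (Rm N s hs h) : 𝓢(E, ℂ)) ξ = (phiN N (s * ((2 * Real.pi) ^ 2 * ‖ξ‖ ^ 2)) : ℂ) * (𝓕 h : 𝓢(E, ℂ)) ξ := by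
  have e1 : (𝓕 (Rm N s hs h) : 𝓢(E, ℂ)) = 𝓕 h - 𝓕 (heat s hs (∑ k ∈ range N, (((k ! : ℝ)⁻¹ * (-s) ^ k : ℝ) : ℂ) • lapI k h)) :=
    map_sub (FourierTransform.fourierCLM ℂ 𝓢(E, ℂ)) _ _
  have e2 : (𝓕 (∑ k ∈ range N, (((k ! : ℝ)⁻¹ * (-s) ^ k : ℝ) : ℂ) • lapI k h) : 𝓢(E, ℂ)) =
      ∑ k ∈ range N, (((k ! : ℝ)⁻¹ * (-s) ^ k : ℝ) : ℂ) • (𝓕 (lapI k h) : 𝓢(E, ℂ)) := by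
    have := map_sum (FourierTransform.fourierCLM ℂ 𝓢(E, ℂ)) (fun k => (((k ! : ℝ)⁻¹ * (-s) ^ k : ℝ) : ℂ) • lapI k h) (range N)
    simp only [map_smul] at this
    exact this
  rw [e1, _root_.sub_apply, fourier_heat, e2, _root_.sum_apply]
  simp only [_root_.smul_apply, lapI, fourier_lap_iter, smul_eq_mul]
  rw [phiN, Complex.ofReal_sub, sub_mul, Complex.ofReal_one, one_mul, Complex.ofReal_mul (Real.exp _), mul_assoc, Complex.ofReal_sum,
    Finset.sum_mul]
  congr 2
  refine Finset.sum_congr rfl fun k _ => ?_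
  push_cast
  rw [neg_pow, neg_pow (_ * _), mul_pow (s : ℂ)]
  have : ((-1 : ℂ) ^ k) * (-1) ^ k = 1 := by rw [← mul_pow]; simp
  linear_combination ((k ! : ℂ)⁻¹ * (s : ℂ) ^ k * ((2 * Real.pi) ^ 2 * ‖ξ‖ ^ 2) ^ k * (𝓕 h : 𝓢(E, ℂ)) ξ) * this

lemma Rm_ld (N : ℕ) (s : ℝ) (hs : 0 < s) (h : 𝓢(E, ℂ)) (v : E) :
    (∂_{v} (Rm N s hs h) : 𝓢(E, ℂ)) = Rm N s hs (∂_{v} h) := by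
  apply fourier_inj
  intro ξ
  rw [fourier_ld, fourier_Rm, fourier_Rm, fourier_ld]
  ring

lemma ld_comm (v w : E) (h : 𝓢(E, ℂ)) : (∂_{v} (∂_{w} h : 𝓢(E, ℂ)) : 𝓢(E, ℂ)) = ∂_{w} (∂_{v} h : 𝓢(E, ℂ)) := by
  apply fourier_inj
  intro ξ
  rw [fourier_ld, fourier_ld, fourier_ld, fourier_ld]
  ring

lemma Rm_bound (N : ℕ) (hN : 1 ≤ N) (s : ℝ) (hs : 0 < s) (h : 𝓢(E, ℂ)) (z : E) (d : ℕ)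
    (hd : Module.finrank ℝ E = 2 * d) (S : ℝ) (hS : ∀ z, ‖lapI N h z‖ ≤ S) :
    ‖Rm N s hs h z‖ ≤ 2 * s ^ N * S := by
  obtain ⟨n, rfl⟩ : ∃ n, N = n + 1 := ⟨N - 1, by omega⟩
  have hS0 : 0 ≤ S := (norm_nonneg _).trans (hS 0)
  set A : E → ℝ := fun ξ => (2 * Real.pi) ^ 2 * ‖ξ‖ ^ 2 with hA
  have hA0 : ∀ ξ, 0 ≤ A ξ := fun ξ => by positivity
  set fh : 𝓢(E, ℂ) := 𝓕 h with hfh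
  set F : ℝ → E → ℂ := fun u ξ => en ⟪ξ, z⟫ * ((phiN (n + 1) (u ^ 2 * A ξ) : ℂ) * fh ξ) with hF
  set F' : ℝ → E → ℂ := fun u ξ => en ⟪ξ, z⟫ *
    (((Real.exp (-(u ^ 2 * A ξ)) * ((n ! : ℝ)⁻¹ * (u ^ 2 * A ξ) ^ n) * (2 * u * A ξ) : ℝ) : ℂ) * fh ξ) with hF'
  have hAi : Integrable (fun ξ => A ξ * ‖fh ξ‖) := by
    have := (fh.integrable_pow_mul volume 2).const_mul ((2 * Real.pi) ^ 2)
    simpa [hA, mul_assoc] using this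
  have hφc : Continuous (phiN (n + 1)) := by unfold phiN; fun_prop
  have hAc : Continuous A := by fun_prop
  have hfc : Continuous fh := fh.continuous
  have hec : Continuous (fun ξ : E => en ⟪ξ, z⟫) := continuous_en.comp (by fun_prop)
  have hder : ∀ u : ℝ, HasDerivAt (fun u => ∫ ξ, F u ξ) (∫ ξ, F' u ξ) u := by
    intro u
    refine (hasDerivAt_integral_of_dominated_loc_of_deriv_le (s := Metric.ball u 1)
      (bound := fun ξ => 2 * (|u| + 1) * (A ξ * ‖fh ξ‖)) (Metric.ball_mem_nhds _ one_pos) ?_ ?_ ?_ ?_ ?_ ?_).2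
    · exact Filter.Eventually.of_forall fun v => Continuous.aestronglyMeasurable (by
        simp only [hF]; fun_prop)
    · refine (fh.integrable (μ := volume)).norm.mono' (Continuous.aestronglyMeasurable (by
        simp only [hF]; fun_prop)) (Filter.Eventually.of_forall fun ξ => ?_)
      simp only [hF, norm_mul, norm_en, one_mul, Complex.norm_real, Real.norm_eq_abs]
      exact mul_le_of_le_one_left (norm_nonneg _) (phiN_bd _ _ (mul_nonneg (sq_nonneg _) (hA0 _)))
    · exact Continuous.aestronglyMeasurable (by simp only [hF']; fun_prop)
    · refine Filter.Eventually.of_forall fun ξ v hv => ?_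
      have hx : 0 ≤ v ^ 2 * A ξ := mul_nonneg (sq_nonneg _) (hA0 _)
      simp only [hF', norm_mul, norm_en, one_mul, Complex.norm_real, Real.norm_eq_abs, abs_mul]
      have hv' : |v| ≤ |u| + 1 := by
        rw [Metric.mem_ball, Real.dist_eq] at hv
        have := abs_sub_abs_le_abs_sub v u
        linarith
      have h1 : |Real.exp (-(v ^ 2 * A ξ))| * (|(n ! : ℝ)⁻¹| * |(v ^ 2 * A ξ) ^ n|) ≤ 1 := by
        rw [abs_of_nonneg (Real.exp_pos _).le, abs_of_nonneg (by positivity), abs_of_nonneg (by positivity)]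
        have := Real.pow_div_factorial_le_exp (v ^ 2 * A ξ) hx n
        calc _ ≤ Real.exp (-(v ^ 2 * A ξ)) * Real.exp (v ^ 2 * A ξ) := by
              gcongr; rw [← div_eq_inv_mul]; exact this
          _ = 1 := by rw [← Real.exp_add]; simp
      calc _ ≤ 1 * (|2| * |v| * |A ξ|) * ‖fh ξ‖ := by gcongr
        _ ≤ 1 * (|2| * (|u| + 1) * |A ξ|) * ‖fh ξ‖ := by gcongr
        _ = _ := by rw [abs_of_nonneg (hA0 ξ), abs_of_pos (by norm_num : (0:ℝ) < 2)]; ring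
    · exact hAi.const_mul _
    · refine Filter.Eventually.of_forall fun ξ v _ => ?_
      simp only [hF, hF']
      have h1 : HasDerivAt (fun v : ℝ => v ^ 2 * A ξ) (2 * v * A ξ) v := by
        simpa using (hasDerivAt_pow 2 v).mul_const (A ξ)
      have h2 := ((phiN_deriv n (v ^ 2 * A ξ)).comp v h1).ofReal_comp
      exact (h2.mul_const _).const_mul _
  have hbd : ∀ u ∈ Set.Icc (0 : ℝ) (Real.sqrt s), ‖∫ ξ, F' u ξ‖ ≤ 2 * Real.sqrt s ^ (2 * n + 1) * S := by
    intro u hu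
    rcases hu.1.eq_or_lt with h0 | h0
    · have : ∫ ξ, F' u ξ = 0 := by
        rw [← h0]; simp [hF']
      rw [this, norm_zero]; positivity
    · have e : ∫ ξ, F' u ξ = (((n ! : ℝ)⁻¹ * (2 * u ^ (2 * n + 1)) * (-1) ^ (n + 1) : ℝ) : ℂ) * heat (u ^ 2) (by positivity) (lapI (n + 1) h) z := by
        rw [inv_en (heat _ _ _), ← integral_const_mul]
        congr with ξ
        rw [fourier_heat, lapI, fourier_lap_iter]
        simp only [hF', hA]
        push_cast
        rw [neg_pow (_ * _)]
        have : ((-1 : ℂ) ^ (n + 1)) * (-1) ^ (n + 1) = 1 := by rw [← mul_pow]; simp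
        generalize Complex.exp _ = e1
        rw [hfh]
        linear_combination (-((n ! : ℂ)⁻¹ * (2 * u ^ (2 * n + 1)) * en ⟪ξ, z⟫ * e1 * ((2 * Real.pi) ^ 2 * ‖ξ‖ ^ 2) ^ (n + 1) * (𝓕 h : 𝓢(E, ℂ)) ξ)) * this
      rw [e, norm_mul, Complex.norm_real, Real.norm_eq_abs, abs_mul, abs_pow, abs_neg, abs_one, one_pow, mul_one,
        abs_of_nonneg (by positivity)]
      have h1 := heat_bound (u ^ 2) (by positivity) (lapI (n + 1) h) z d hd S hS
      have h2 : (n ! : ℝ)⁻¹ ≤ 1 := inv_le_one_of_one_le₀ (by exact_mod_cast Nat.one_le_iff_ne_zero.2 (Nat.factorial_ne_zero n))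
      calc _ ≤ 1 * (2 * Real.sqrt s ^ (2 * n + 1)) * S := by gcongr; exact hu.2
        _ = _ := by ring
  have hmv := norm_image_sub_le_of_norm_deriv_le_segment' (f := fun u => ∫ ξ, F u ξ) (f' := fun u => ∫ ξ, F' u ξ)
    (a := 0) (b := Real.sqrt s) (fun u _ => (hder u).hasDerivWithinAt) (fun u hu => hbd u ⟨hu.1, hu.2.le⟩)
    (Real.sqrt s) ⟨Real.sqrt_nonneg _, le_rfl⟩
  have e0 : ∫ ξ, F 0 ξ = 0 := by
    simp [hF, phiN, Finset.sum_range_succ']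
  have es : ∫ ξ, F (Real.sqrt s) ξ = Rm (n + 1) s hs h z := by
    rw [inv_en (Rm _ _ _ _)]
    congr with ξ
    rw [fourier_Rm]
    simp only [hF, Real.sq_sqrt hs.le, hA, hfh]
  rw [e0, es, sub_zero, sub_zero] at hmv
  refine hmv.trans (le_of_eq ?_)
  have : s ^ (n + 1) = Real.sqrt s ^ (2 * (n + 1)) := by rw [pow_mul, Real.sq_sqrt hs.le]
  rw [this]
  ring

end heat
end WAW

namespace WAW
open SchwartzMap
open scoped Nat ContDiff ENNReal FourierTransform LineDeriv Laplacian RealInnerProductSpace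

section ld
variable {E : Type*} [NormedAddCommGroup E] [InnerProductSpace ℝ E] [FiniteDimensional ℝ E]
  [MeasurableSpace E] [BorelSpace E] {ι : Type*} [Fintype ι]

/-- list of line derivatives -/
def LD {G V : Type*} [NormedAddCommGroup G] [NormedSpace ℝ G] [NormedAddCommGroup V] [NormedSpace ℝ V]
    (b : ι → G) (l : List ι) (h : 𝓢(G, V)) : 𝓢(G, V) := l.foldr (fun i f => ∂_{b i} f) h

lemma LD_cons {G V : Type*} [NormedAddCommGroup G] [NormedSpace ℝ G] [NormedAddCommGroup V] [NormedSpace ℝ V]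
    (b : ι → G) (i : ι) (l : List ι) (h : 𝓢(G, V)) : LD b (i :: l) h = ∂_{b i} (LD b l h) := rfl

lemma LD_ofFn (b : ι → E) (j : ℕ) (σ : Fin j → ι) (h : 𝓢(E, ℂ)) :
    (∂^{fun k => b (σ k)} h : 𝓢(E, ℂ)) = LD b (List.ofFn σ) h := by
  induction j with
  | zero => simp [LD]
  | succ j ih =>
    rw [LineDeriv.iteratedLineDerivOp_succ_left, List.ofFn_succ, LD_cons, ← ih]
    rfl

lemma iterFD_bound (b : OrthonormalBasis ι ℝ E) (j : ℕ) (h : 𝓢(E, ℂ)) (z : E) (K : ℝ) (hK : 0 ≤ K)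
    (hl : ∀ l : List ι, l.length = j → ‖LD b l h z‖ ≤ K) :
    ‖iteratedFDeriv ℝ j h z‖ ≤ (Fintype.card ι : ℝ) ^ j * K := by
  classical
  refine ContinuousMultilinearMap.opNorm_le_bound (by positivity) fun m => ?_
  have e : ∀ k, m k = ∑ i, ⟪b i, m k⟫ • b i := fun k => (b.sum_repr' (m k)).symm
  have e2 : iteratedFDeriv ℝ j h z m = ∑ σ : Fin j → ι, (∏ k, ⟪b (σ k), m k⟫) • iteratedFDeriv ℝ j h z (fun k => b (σ k)) := by
    conv_lhs => rw [show m = fun k => ∑ i, ⟪b i, m k⟫ • b i from funext e]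
    rw [ContinuousMultilinearMap.map_sum]
    refine Finset.sum_congr rfl fun σ _ => ?_
    rw [ContinuousMultilinearMap.map_smul_univ]
  rw [e2]
  refine (norm_sum_le _ _).trans ?_
  calc _ ≤ ∑ σ : Fin j → ι, (∏ k, ‖m k‖) * K := by
        refine Finset.sum_le_sum fun σ _ => ?_
        rw [norm_smul, norm_prod]
        gcongr with k
        · refine (norm_inner_le_norm _ _).trans ?_
          rw [b.norm_eq_one, one_mul]
        · rw [← iteratedLineDerivOp_eq_iteratedFDeriv, LD_ofFn]
          exact hl _ (by simp)
    _ = _ := by simp [Finset.sum_const]; ring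

lemma Rm_LD (N : ℕ) (s : ℝ) (hs : 0 < s) (b : ι → E) (l : List ι) (h : 𝓢(E, ℂ)) :
    LD b l (Rm N s hs h) = Rm N s hs (LD b l h) := by
  induction l with
  | nil => rfl
  | cons i l ih => rw [LD_cons, LD_cons, ih, Rm_ld]

lemma lapI_sum {κ : Type*} (N : ℕ) (s : Finset κ) (f : κ → 𝓢(E, ℂ)) :
    lapI N (∑ i ∈ s, f i) = ∑ i ∈ s, lapI N (f i) := by
  induction N with
  | zero => rfl
  | succ N ih =>
    simp only [lapI, Function.iterate_succ_apply'] at ih ⊢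
    rw [ih]
    exact map_sum (LineDeriv.laplacianCLM ℝ E 𝓢(E, ℂ)) _ _

lemma lap_bound (b : OrthonormalBasis ι ℝ E) (N : ℕ) (h : 𝓢(E, ℂ)) (K : ℝ) :
    ∀ (j : ℕ), (∀ l : List ι, l.length = 2 * N + j → ∀ z, ‖LD b l h z‖ ≤ K) →
      ∀ l : List ι, l.length = j → ∀ z, ‖lapI N (LD b l h) z‖ ≤ (Fintype.card ι : ℝ) ^ N * K := by
  induction N with
  | zero =>
    intro j hK l hl z
    simpa [lapI] using hK l (by omega) z
  | succ N ih =>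
    intro j hK l hl z
    have e : lapI (N + 1) (LD b l h) = ∑ i, lapI N (LD b (i :: i :: l) h) := by
      rw [← lapI_sum, lapI, Function.iterate_succ_apply, laplacian_eq_sum b]
      rfl
    rw [e, _root_.sum_apply]
    refine (norm_sum_le _ _).trans ?_
    calc _ ≤ ∑ i : ι, (Fintype.card ι : ℝ) ^ N * K := Finset.sum_le_sum fun i _ =>
          ih (j + 2) (fun l hl => hK l (by omega)) (i :: i :: l) (by simp [hl]) z
      _ = _ := by simp [Finset.sum_const]; ring

lemma Rm_iterFD (b : OrthonormalBasis ι ℝ E) (N : ℕ) (hN : 1 ≤ N) (s : ℝ) (hs : 0 < s) (h : 𝓢(E, ℂ)) (K : ℝ) (d : ℕ)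
    (hK0 : 0 ≤ K)
    (hd : Module.finrank ℝ E = 2 * d) (j : ℕ) (hK : ∀ l : List ι, l.length = 2 * N + j → ∀ z, ‖LD b l h z‖ ≤ K) (z : E) :
    ‖iteratedFDeriv ℝ j (Rm N s hs h) z‖ ≤ (Fintype.card ι : ℝ) ^ j * (2 * s ^ N * ((Fintype.card ι : ℝ) ^ N * K)) := by
  refine iterFD_bound b j _ z _ (by positivity) fun l hl => ?_
  rw [Rm_LD]
  exact Rm_bound N hN s hs _ z d hd _ (lap_bound b N h K j hK l hl)

end ld
end WAW

namespace WAW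
open SchwartzMap
open scoped Nat ContDiff ENNReal FourierTransform LineDeriv Laplacian RealInnerProductSpace

section conc
variable {d : ℕ}

/-- unpack -/
def unpk (d : ℕ) : PE (EY d) ≃L[ℝ] PS d :=
  (WithLp.prodContinuousLinearEquiv 2 ℝ (EY d) (EY d)).trans
    ((EuclideanSpace.equiv (Fin d) ℝ).prodCongr (EuclideanSpace.equiv (Fin d) ℝ))

lemma unpk_pk (z : PS d) : unpk d (pk z) = z := rfl
lemma pk_unpk (z : PE (EY d)) : pk (unpk d z) = z := rfl

/-- transfer of symbols -/
def up (a : 𝓢(PS d, ℝ)) : 𝓢(PE (EY d), ℂ) :=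
  compCLMOfContinuousLinearEquiv ℝ (unpk d) (postcompCLM Complex.ofRealCLM a)

lemma up_apply (a : 𝓢(PS d, ℝ)) (z : PE (EY d)) : up a z = (a (unpk d z) : ℂ) := rfl

lemma up_sum {κ : Type*} (s : Finset κ) (f : κ → 𝓢(PS d, ℝ)) : up (∑ i ∈ s, f i) = ∑ i ∈ s, up (f i) := by
  simp [up, map_sum]

lemma up_add (f g : 𝓢(PS d, ℝ)) : up (f + g) = up f + up g := by
  simp [up, map_add]

/-- basis of PS -/
def eb (d : ℕ) : Fin d ⊕ Fin d → PS d := Sum.elim (fun i => (Pi.single i 1, 0)) (fun i => (0, Pi.single i 1))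

/-- basis of PE -/
def bb (d : ℕ) : OrthonormalBasis (Fin d ⊕ Fin d) ℝ (PE (EY d)) :=
  (EuclideanSpace.basisFun (Fin d) ℝ).prod (EuclideanSpace.basisFun (Fin d) ℝ)

lemma unpk_bb (i : Fin d ⊕ Fin d) : unpk d (bb d i) = eb d i := by
  rw [bb, OrthonormalBasis.prod_apply]
  rcases i with i | i
  · refine Prod.ext ?_ ?_
    · ext j; simp [unpk, eb, Pi.single_apply]
    · ext j; simp [unpk, eb, Pi.single_apply]
  · refine Prod.ext ?_ ?_
    · ext j; simp [unpk, eb, Pi.single_apply]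
    · ext j; simp [unpk, eb, Pi.single_apply]

lemma up_ld (i : Fin d ⊕ Fin d) (a : 𝓢(PS d, ℝ)) :
    (∂_{bb d i} (up a) : 𝓢(PE (EY d), ℂ)) = up (∂_{eb d i} a) := by
  ext z
  rw [up_apply, lineDerivOp_apply, lineDerivOp_apply, lineDeriv, lineDeriv]
  have h1 : ∀ t : ℝ, up a (z + t • bb d i) = ((a (unpk d z + t • eb d i) : ℝ) : ℂ) := by
    intro t; rw [up_apply, map_add, map_smul, unpk_bb]
  simp_rw [h1]
  have hd : DifferentiableAt ℝ (fun t : ℝ => a (unpk d z + t • eb d i)) 0 := by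
    have := a.differentiable
    fun_prop
  exact hd.hasDerivAt.ofReal_comp.deriv

lemma up_LD (l : List (Fin d ⊕ Fin d)) (a : 𝓢(PS d, ℝ)) : LD (bb d) l (up a) = up (LD (eb d) l a) := by
  induction l with
  | nil => rfl
  | cons i l ih => rw [LD_cons, LD_cons, ih, up_ld]

lemma upd_eq (x : Fin d → ℝ) (i : Fin d) (t : ℝ) :
    Function.update x i t = x + (t - x i) • (Pi.single i 1 : Fin d → ℝ) := by
  ext j
  by_cases h : j = i
  · subst h; simp
  · simp [h]

lemma pdQ_eq (i : Fin d) (a : 𝓢(PS d, ℝ)) : pdQ i (⇑a) = ⇑(∂_{eb d (Sum.inl i)} a : 𝓢(PS d, ℝ)) := by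
  ext z
  rw [lineDerivOp_apply, lineDeriv, pdQ]
  have h1 : ∀ t, a (Function.update z.1 i t, z.2) = (fun t => a (z + t • eb d (Sum.inl i))) (t - z.1 i) := by
    intro t
    rw [upd_eq]
    congr 1
    refine Prod.ext ?_ ?_ <;> simp [eb]
  simp_rw [h1]
  rw [deriv_comp_sub_const (fun t => a (z + t • eb d (Sum.inl i))), sub_self]

lemma pdP_eq (i : Fin d) (a : 𝓢(PS d, ℝ)) : pdP i (⇑a) = ⇑(∂_{eb d (Sum.inr i)} a : 𝓢(PS d, ℝ)) := by
  ext z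
  rw [lineDerivOp_apply, lineDeriv, pdP]
  have h1 : ∀ t, a (z.1, Function.update z.2 i t) = (fun t => a (z + t • eb d (Sum.inr i))) (t - z.2 i) := by
    intro t
    rw [upd_eq]
    congr 1
    refine Prod.ext ?_ ?_ <;> simp [eb]
  simp_rw [h1]
  rw [deriv_comp_sub_const (fun t => a (z + t • eb d (Sum.inr i))), sub_self]

lemma LD_append {ι G V : Type*} [Fintype ι] [NormedAddCommGroup G] [NormedSpace ℝ G] [NormedAddCommGroup V] [NormedSpace ℝ V]
    (b : ι → G) (l l' : List ι) (h : 𝓢(G, V)) : LD b (l ++ l') h = LD b l (LD b l' h) := by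
  simp [LD, List.foldr_append]

/-- canonical list -/
def canon (δ : Fin d ⊕ Fin d → ℕ) : List (Fin d ⊕ Fin d) :=
  (List.finRange d).flatMap (fun i => List.replicate (δ (Sum.inl i)) (Sum.inl i)) ++
    (List.finRange d).flatMap (fun i => List.replicate (δ (Sum.inr i)) (Sum.inr i))

lemma fold_aux (op : Fin d → (PS d → ℝ) → (PS d → ℝ)) (c : Fin d → Fin d ⊕ Fin d)
    (hop : ∀ i (a : 𝓢(PS d, ℝ)), op i (⇑a) = ⇑(∂_{eb d (c i)} a : 𝓢(PS d, ℝ))) (n : Fin d → ℕ)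
    (L : List (Fin d)) (a : 𝓢(PS d, ℝ)) :
    L.foldr (fun i g => (op i)^[n i] g) (⇑a) = ⇑(LD (eb d) (L.flatMap (fun i => List.replicate (n i) (c i))) a) := by
  induction L with
  | nil => rfl
  | cons i L ih =>
    rw [List.foldr_cons, ih, List.flatMap_cons, LD_append]
    generalize LD (eb d) (L.flatMap (fun i => List.replicate (n i) (c i))) a = g
    induction n i with
    | zero => rfl
    | succ k ihk => rw [Function.iterate_succ_apply', ihk, hop, List.replicate_succ, LD_cons]

lemma mpdPS_eq (δ : Fin d ⊕ Fin d → ℕ) (a : 𝓢(PS d, ℝ)) : mpdPS δ (⇑a) = ⇑(LD (eb d) (canon δ) a) := by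
  rw [mpdPS, fold_aux pdP Sum.inr pdP_eq (fun i => δ (Sum.inr i)),
    fold_aux pdQ Sum.inl pdQ_eq (fun i => δ (Sum.inl i)), canon, LD_append]

instance lawfulSum : LawfulBEq (Fin d ⊕ Fin d) where
  rfl := by
    intro a
    rcases a with a | a
    · exact beq_self_eq_true a
    · exact beq_self_eq_true a
  eq_of_beq := by
    intro a b h
    rcases a with a | a <;> rcases b with b | b
    · exact congrArg _ (eq_of_beq (show (a == b) = true from h))
    · exact absurd (show false = true from h) Bool.false_ne_true
    · exact absurd (show false = true from h) Bool.false_ne_true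
    · exact congrArg _ (eq_of_beq (show (a == b) = true from h))

lemma count_aux (c : Fin d → Fin d ⊕ Fin d) (hc : Function.Injective c) (n : Fin d → ℕ) (i : Fin d) :
    ((List.finRange d).flatMap (fun i => List.replicate (n i) (c i))).count (c i) = n i := by
  rw [List.count_flatMap]
  have : (List.count (c i) ∘ fun i => List.replicate (n i) (c i)) = fun j => if j = i then n i else 0 := by
    ext j
    simp only [Function.comp, List.count_replicate]
    by_cases h : j = i
    · simp [h]
    · simp [h, hc.eq_iff]
  rw [this, ← List.ofFn_eq_map, List.sum_ofFn]
  simp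

lemma canon_perm (l : List (Fin d ⊕ Fin d)) : l.Perm (canon (fun i => l.count i)) := by
  rw [List.perm_iff_count]
  intro i
  rw [canon, List.count_append]
  rcases i with i | i
  · have h0 : List.count (Sum.inl i : Fin d ⊕ Fin d) ((List.finRange d).flatMap
        (fun i => List.replicate (l.count (Sum.inr i)) (Sum.inr i))) = 0 :=
      List.count_eq_zero_of_not_mem (by simp)
    rw [count_aux Sum.inl Sum.inl_injective (fun i => l.count (Sum.inl i)), h0, add_zero]
  · have h0 : List.count (Sum.inr i : Fin d ⊕ Fin d) ((List.finRange d).flatMap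
        (fun i => List.replicate (l.count (Sum.inl i)) (Sum.inl i))) = 0 :=
      List.count_eq_zero_of_not_mem (by simp)
    rw [count_aux Sum.inr Sum.inr_injective (fun i => l.count (Sum.inr i)), h0, zero_add]

lemma LD_perm {ι E : Type*} [Fintype ι] [NormedAddCommGroup E] [InnerProductSpace ℝ E] [FiniteDimensional ℝ E]
    [MeasurableSpace E] [BorelSpace E] (b : ι → E) {l l' : List ι} (hp : l.Perm l') (h : 𝓢(E, ℂ)) :
    LD b l h = LD b l' h := by
  induction hp with
  | nil => rfl
  | cons x _ ih => rw [LD_cons, LD_cons, ih]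
  | swap x y l => rw [LD_cons, LD_cons, LD_cons, LD_cons, ld_comm]
  | trans _ _ h1 h2 => rw [h1, h2]

lemma LD_mpd (l : List (Fin d ⊕ Fin d)) (a : 𝓢(PS d, ℝ)) (z : PE (EY d)) :
    ‖LD (bb d) l (up a) z‖ = ‖mpdPS (fun i => l.count i) (⇑a) (unpk d z)‖ := by
  rw [LD_perm _ (canon_perm l), up_LD, up_apply, Complex.norm_real, mpdPS_eq]

lemma sum_count (l : List (Fin d ⊕ Fin d)) : ∑ i, l.count i = l.length := by
  induction l with
  | nil => simp
  | cons a l ih =>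
    simp only [List.count_cons, Finset.sum_add_distrib, ih, List.length_cons]
    congr 1
    simp

end conc
end WAW

namespace WAW
open SchwartzMap
open scoped Nat ContDiff ENNReal FourierTransform LineDeriv Laplacian RealInnerProductSpace

section asm
variable {d : ℕ}

/-- Schwartz Laplacian on PS -/
def lapP (a : 𝓢(PS d, ℝ)) : 𝓢(PS d, ℝ) := ∑ i : Fin d ⊕ Fin d, ∂_{eb d i} (∂_{eb d i} a)

lemma dd_Q (i : Fin d) (f : PS d → ℝ) (z : PS d) :
    iteratedDeriv 2 (fun t => f (Function.update z.1 i t, z.2)) (z.1 i) = pdQ i (pdQ i f) z := by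
  rw [iteratedDeriv_succ, iteratedDeriv_one]
  simp only [pdQ, Function.update_idem, Function.update_self]

lemma dd_P (i : Fin d) (f : PS d → ℝ) (z : PS d) :
    iteratedDeriv 2 (fun t => f (z.1, Function.update z.2 i t)) (z.2 i) = pdP i (pdP i f) z := by
  rw [iteratedDeriv_succ, iteratedDeriv_one]
  simp only [pdP, Function.update_idem, Function.update_self]

lemma phaseLap_eq (a : 𝓢(PS d, ℝ)) : phaseLap (⇑a) = ⇑(lapP a) := by
  ext z
  rw [phaseLap, lapP, _root_.sum_apply, Fintype.sum_sum_type]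
  simp_rw [dd_Q, dd_P, pdQ_eq, pdP_eq]

lemma phaseLap_iter (k : ℕ) (a : 𝓢(PS d, ℝ)) : phaseLap^[k] (⇑a) = ⇑(lapP^[k] a) := by
  induction k with
  | zero => rfl
  | succ k ih => rw [Function.iterate_succ_apply', Function.iterate_succ_apply', ih, phaseLap_eq]

lemma up_lapP (a : 𝓢(PS d, ℝ)) : (Δ (up a) : 𝓢(PE (EY d), ℂ)) = up (lapP a) := by
  rw [laplacian_eq_sum (bb d), lapP, up_sum]
  simp_rw [up_ld]

lemma lapI_up (k : ℕ) (a : 𝓢(PS d, ℝ)) : lapI k (up a) = up (lapP^[k] a) := by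
  induction k with
  | zero => rfl
  | succ k ih =>
    rw [Function.iterate_succ_apply', ← up_lapP, ← ih, lapI, lapI, Function.iterate_succ_apply']

lemma pk_integral (F : PE (EY d) → ℂ) : ∫ z, F z = ∫ w : PS d, F (pk w) := by
  rw [PE_integral]
  have h1 : MeasurePreserving (MeasurableEquiv.prodCongr (MeasurableEquiv.toLp 2 (Fin d → ℝ)) (MeasurableEquiv.toLp 2 (Fin d → ℝ))) :=
    (PiLp.volume_preserving_toLp (Fin d)).prod (PiLp.volume_preserving_toLp (Fin d))
  exact (h1.integral_comp' (fun p => F (WithLp.toLp 2 p))).symm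

lemma pk_norm (w : PS d) : ‖pk w‖ ^ 2 = ∑ i, (w.1 i ^ 2 + w.2 i ^ 2) := by
  rw [pk, WithLp.prod_norm_sq_eq_of_L2, EuclideanSpace.norm_sq_eq, EuclideanSpace.norm_sq_eq, sum_add_distrib]
  simp

lemma fr : Module.finrank ℝ (PE (EY d)) = 2 * d := by
  rw [Module.finrank_eq_card_basis (bb d).toBasis]
  simp; ring

lemma rem_eq (N : ℕ) (ε : ℝ) (hε : 0 < ε) (hs : 0 < ε / 4) (a : 𝓢(PS d, ℝ)) (z : PS d) :
    ((remSymbol N ε (⇑a) z : ℝ) : ℂ) = ((((ε ^ N)⁻¹ : ℝ) : ℂ) • Rm N (ε / 4) hs (up a)) (pk z) := by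
  rw [_root_.smul_apply, Rm, _root_.sub_apply, heat_apply _ _ _ _ d fr, pk_integral, remSymbol, smul_eq_mul]
  rw [Complex.ofReal_mul, Complex.ofReal_sub, ← integral_complex_ofReal, up_apply, unpk_pk]
  congr 2
  refine integral_congr_ae (Filter.Eventually.of_forall fun w => ?_)
  beta_reduce
  have e : pk z - pk w = pk (z - w) := rfl
  rw [e, _root_.sum_apply, pk_norm, gaussW0, corrSymbol]
  rw [show 4 * (ε / 4) = ε by ring, Complex.ofReal_mul]
  congr 1
  rw [Complex.ofReal_sum]
  refine Finset.sum_congr rfl fun k _ => ?_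
  rw [_root_.smul_apply, lapI_up, up_apply, unpk_pk, phaseLap_iter, smul_eq_mul, Complex.ofReal_mul]
  rw [neg_div]

lemma mpd_bdd (δ : Fin d ⊕ Fin d → ℕ) (a : 𝓢(PS d, ℝ)) : BddAbove (Set.range fun z => ‖mpdPS δ (⇑a) z‖) := by
  rw [mpdPS_eq]
  refine ⟨SchwartzMap.seminorm ℝ 0 0 (LD (eb d) (canon δ) a), ?_⟩
  rintro _ ⟨z, rfl⟩
  exact norm_le_seminorm ℝ _ z

lemma fin_idx (A B : ℕ) : Finite {δ : Fin d ⊕ Fin d → ℕ // A ≤ ∑ i, δ i ∧ ∑ i, δ i ≤ B} := by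
  refine Set.Finite.subset (Set.finite_Iic (fun _ : Fin d ⊕ Fin d => B)) ?_
  rintro δ ⟨_, h⟩ i
  exact (Finset.single_le_sum (f := δ) (fun _ _ => Nat.zero_le _) (Finset.mem_univ i)).trans h

lemma LD_le_sup (A B : ℕ) (a : 𝓢(PS d, ℝ)) (l : List (Fin d ⊕ Fin d)) (h1 : A ≤ l.length) (h2 : l.length ≤ B)
    (z : PE (EY d)) :
    ‖LD (bb d) l (up a) z‖ ≤ ⨆ δ : {δ : Fin d ⊕ Fin d → ℕ // A ≤ ∑ i, δ i ∧ ∑ i, δ i ≤ B},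
      ⨆ z : PS d, ‖mpdPS δ.1 (⇑a) z‖ := by
  rw [LD_mpd]
  haveI := fin_idx (d := d) A B
  have h3 := le_ciSup (mpd_bdd (fun i => l.count i) a) (unpk d z)
  refine h3.trans ?_
  exact le_ciSup (f := fun δ : {δ : Fin d ⊕ Fin d → ℕ // A ≤ ∑ i, δ i ∧ ∑ i, δ i ≤ B} =>
    ⨆ z : PS d, ‖mpdPS δ.1 (⇑a) z‖) (Finite.bddAbove_range _)
    ⟨fun i => l.count i, by rw [sum_count]; exact ⟨h1, h2⟩⟩

end asm

end WAW

/-- Weyl versus anti-Wick quantization (quadratic-form version): there is a constant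
`C' ≥ 0` depending only on `d` and `N` such that, with
`C = C' · max{sup |∂^δ a| : 2N ≤ |δ| ≤ 2N + 2(⌈d/2⌉+1)}`, one has
`|⟨ψ, op_ε(r_ε) ψ⟩| ≤ C ‖ψ‖²` for every `ε ∈ (0,1]` and every Schwartz `ψ`. -/
theorem weyl_antiWick_remainder_bound (d N : ℕ) (hd : 1 ≤ d) (hN : 1 ≤ N) :
    ∃ C' : ℝ, 0 ≤ C' ∧
      ∀ (a : SchwartzMap (PS d) ℝ) (ε : ℝ), 0 < ε → ε ≤ 1 →
        ∀ ψ : SchwartzMap (Fin d → ℝ) ℂ,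
          ‖∫ q : Fin d → ℝ,
              (starRingEnd ℂ) (ψ q) *
                weylOp ε (fun z => ((remSymbol N ε (⇑a) z : ℝ) : ℂ)) (⇑ψ) q‖ ≤
            (C' *
              ⨆ δ : {δ : Fin d ⊕ Fin d → ℕ //
                  2 * N ≤ ∑ i, δ i ∧ ∑ i, δ i ≤ 2 * N + 2 * ((d + 1) / 2 + 1)},
                ⨆ z : PS d, ‖mpdPS δ.1 (⇑a) z‖) *
              ∫ x : Fin d → ℝ, ‖ψ x‖ ^ 2 := by
  obtain ⟨C, hC0, hC⟩ := WAW.weyl_bound d ((d + 1) / 2 + 1) (by omega)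
  generalize hM : (d + 1) / 2 + 1 = M at hC ⊢
  refine ⟨C * (2 * ((2 * d : ℝ)) ^ (2 * M + N)), by positivity, fun a ε hε hε1 ψ => ?_⟩
  have hS := WAW.LD_le_sup (2 * N) (2 * N + 2 * M) a
  have hS0 : 0 ≤ ⨆ δ : {δ : Fin d ⊕ Fin d → ℕ // 2 * N ≤ ∑ i, δ i ∧ ∑ i, δ i ≤ 2 * N + 2 * M},
                ⨆ z : PS d, ‖mpdPS δ.1 (⇑a) z‖ :=
    Real.iSup_nonneg fun δ => Real.iSup_nonneg fun z => norm_nonneg _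
  generalize (⨆ δ : {δ : Fin d ⊕ Fin d → ℕ // 2 * N ≤ ∑ i, δ i ∧ ∑ i, δ i ≤ 2 * N + 2 * M},
                ⨆ z : PS d, ‖mpdPS δ.1 (⇑a) z‖) = S at hS hS0 ⊢
  have hs : 0 < ε / 4 := by positivity
  simp_rw [WAW.rem_eq N ε hε hs a]
  have hd1 : (1 : ℝ) ≤ 2 * d := by
    have : (1 : ℝ) ≤ d := by exact_mod_cast hd
    linarith
  have hcard : (Fintype.card (Fin d ⊕ Fin d) : ℝ) = 2 * d := by
    simp; ring
  refine (hC _ (2 * (2 * d : ℝ) ^ (2 * M + N) * S) ε ψ (by positivity) hε hε1 ?_).trans (le_of_eq (by ring))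
  intro j hj z
  have hR := WAW.Rm_iterFD (WAW.bb d) N hN (ε / 4) hs (WAW.up a) S d hS0 WAW.fr j
    (fun l hl z => hS l (by omega) (by omega) z) z
  rw [hcard] at hR
  have hcoe : (⇑((((ε ^ N)⁻¹ : ℝ) : ℂ) • WAW.Rm N (ε / 4) hs (WAW.up a)) : WAW.PE (WAW.EY d) → ℂ)
      = (((ε ^ N)⁻¹ : ℝ) : ℂ) • ⇑(WAW.Rm N (ε / 4) hs (WAW.up a)) := rfl
  rw [hcoe, iteratedFDeriv_const_smul_apply ((WAW.Rm N (ε / 4) hs (WAW.up a)).smooth j).contDiffAt, norm_smul,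
    Complex.norm_real, Real.norm_of_nonneg (by positivity)]
  calc (ε ^ N)⁻¹ * ‖iteratedFDeriv ℝ j (WAW.Rm N (ε / 4) hs (WAW.up a)) z‖
      ≤ (ε ^ N)⁻¹ * ((2 * d : ℝ) ^ j * (2 * (ε / 4) ^ N * ((2 * d : ℝ) ^ N * S))) := by gcongr
    _ = (1 / 4 : ℝ) ^ N * (2 * (2 * d : ℝ) ^ (j + N) * S) := by
        have : ε ^ N ≠ 0 := by positivity
        rw [div_pow, div_pow, pow_add]; field_simp; try ring
    _ ≤ 1 * (2 * (2 * d : ℝ) ^ (2 * M + N) * S) := by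
        gcongr
        · exact pow_le_one₀ (by norm_num) (by norm_num)
    _ = _ := one_mul _
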